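/- Assume B : (0,∞) → [0,∞) is continuous and bounded on some neighborhood of 0 and satisfies (A2), and let U be a continuously differentiable Perron eigenfunction. Let r₁ < 1 < r₂ and w(x) = x^{r₁} + x^{r₂}. Then there exist constants C ≥ 1 and a > 0 such that for every f ∈ B(w) and every t > 0, ‖(1/log 2) ∫_t^{t+log 2} e^{−s} M_s f ds − ν₀(f)·id‖_{B(w)} ≤ C e^{−a t} ‖f − ν₀(f)·id‖_{B(w)} and ‖(1/t) ∫₀^t e^{−s} M_s f ds − ν₀(f)·id‖_{B(w)} ≤ (C/t) ‖f − ν₀(f)·id‖_{B(w)}, where ν₀(f) = ∫₀^∞ U(y) f(y) dy and id(x) = x. -/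

import Mathlib

open MeasureTheory Real Set Filter Topology

noncomputable section

/-- A function on `(0,∞)` is locally bounded if it is bounded on the intersection of
`(0,∞)` with every bounded set. -/
def LocBddOn (f : ℝ → ℝ) : Prop :=
  ∀ r > 0, ∃ C, ∀ x, 0 < x → x ≤ r → |f x| ≤ C

/-- A function on `[0,∞) × (0,∞)` is locally bounded if it is bounded on the intersection of
`[0,∞) × (0,∞)` with every bounded set. -/
def LocBdd2 (φ : ℝ → ℝ → ℝ) : Prop :=
  ∀ r > 0, ∃ C, ∀ t x, 0 ≤ t → t ≤ r → 0 < x → x ≤ r → |φ t x| ≤ C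

/-- Mild solution of the dual mitosis equation with initial datum `f`. -/
def IsMildSol (B f : ℝ → ℝ) (φ : ℝ → ℝ → ℝ) : Prop :=
  ∀ t ≥ 0, ∀ x > 0,
    φ t x = f (x * exp t) * Real.exp (-∫ s in (0:ℝ)..t, B (x * exp s))
      + 2 * ∫ τ in (0:ℝ)..t,
          B (x * exp τ) * Real.exp (-∫ s in (0:ℝ)..τ, B (x * exp s)) * φ (t - τ) (x * exp τ / 2)

/-- `B : (0,∞) → [0,∞)` is continuous and bounded on some neighborhood of `0`. -/
def Bhyp (B : ℝ → ℝ) : Prop :=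
  ContinuousOn B (Ioi 0) ∧ (∀ x > 0, 0 ≤ B x) ∧
    ∃ ε > 0, ∃ C, ∀ x, 0 < x → x < ε → B x ≤ C

/-- Assumption (A2) on the division rate: local integrability, support `[b,∞)`,
power-law bound near `0` and two-sided power-law bounds at infinity. -/
def HypA2 (B : ℝ → ℝ) : Prop :=
  (∀ a b : ℝ, 0 < a → IntegrableOn B (Icc a b)) ∧
  (∃ b ≥ (0:ℝ), closure {x : ℝ | 0 < x ∧ B x ≠ 0} = Ici b) ∧
  (∃ b₀ > (0:ℝ), ∃ γ₀ > (0:ℝ), ∃ K₀ > (0:ℝ), ∀ x, 0 < x → x < b₀ → B x ≤ K₀ * x ^ γ₀) ∧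
  (∃ b₁ > (0:ℝ), ∃ γ₁ > (0:ℝ), ∃ γ₂ > (0:ℝ), ∃ K₁ > (0:ℝ), ∃ K₂ > (0:ℝ),
    ∀ x, b₁ < x → K₁ * x ^ γ₁ ≤ B x ∧ B x ≤ K₂ * x ^ γ₂)

/-- `U` is a continuously differentiable Perron eigenfunction (with derivative `U'`):
nonnegative, solves `(xU)' + (B+1)U = 4B(2x)U(2x)`, is normalized by `∫ x U = 1`,
and `x^r U` is bounded and integrable on `(0,∞)` for every real `r`. -/
def Perron (B U U' : ℝ → ℝ) : Prop :=
  (∀ x > 0, 0 ≤ U x) ∧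
  (∀ x > 0, HasDerivAt U (U' x) x) ∧
  ContinuousOn U' (Ioi 0) ∧
  (∀ x > 0, (U x + x * U' x) + (B x + 1) * U x = 4 * B (2 * x) * U (2 * x)) ∧
  (∫ x in Ioi (0:ℝ), x * U x) = 1 ∧
  (∀ r : ℝ, (∃ C, ∀ x > 0, x ^ r * U x ≤ C) ∧ IntegrableOn (fun x => x ^ r * U x) (Ioi 0))

/-- The Lyapunov function in logarithmic coordinates. -/
def VV (p q z : ℝ) : ℝ := exp (-p * z) + exp (q * z)

lemma VV_pos (p q z : ℝ) : 0 < VV p q z := by unfold VV; positivity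

lemma VV_ge_one {p q : ℝ} (hp : 0 < p) (hq : 0 < q) (z : ℝ) : 1 ≤ VV p q z := by
  unfold VV
  rcases le_total 0 z with h | h
  · have : 1 ≤ exp (q * z) := one_le_exp (by positivity)
    have := exp_pos (-p * z)
    linarith
  · have : 1 ≤ exp (-p * z) := one_le_exp (by nlinarith)
    have := exp_pos (q * z)
    linarith

lemma VV_cont (p q : ℝ) : Continuous (VV p q) := by unfold VV; fun_prop

lemma pos1d (f f' : ℝ → ℝ) (a T : ℝ) (hf : ContinuousOn f (Icc a T))
    (hd : ∀ t ∈ Ico a T, HasDerivWithinAt f (f' t) (Ici t) t) (h0 : 0 ≤ f a)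
    (hneg : ∀ t ∈ Ico a T, f t < 0 → 0 ≤ f' t) : ∀ t ∈ Icc a T, 0 ≤ f t := by
  have key : ∀ ε > 0, ∀ t ∈ Icc a T, -f t ≤ ε * (1 + (t - a)) := by
    intro ε hε t ht
    refine image_le_of_deriv_right_lt_deriv_boundary (f := fun t => -f t) (f' := fun t => -f' t)
      (B := fun t => ε * (1 + (t - a))) (B' := fun _ => ε) (a := a) (b := T) hf.neg
      (fun x hx => (hd x hx).neg) (by simp; linarith) ?_ ?_ ht
    · intro x
      have := (((hasDerivAt_id x).sub_const a).const_add 1).const_mul ε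
      simpa using this
    · intro x hx hfx
      have hx0 : 0 ≤ x - a := by linarith [hx.1]
      have : 0 < ε * (1 + (x - a)) := by positivity
      have h2 := hneg x hx (by linarith)
      linarith
  intro t ht
  by_contra hcon
  push Not at hcon
  have h1 : 0 < 1 + (t - a) := by linarith [ht.1]
  have := key (-f t / (2 * (1 + (t - a)))) (by apply div_pos <;> linarith) t ht
  have h3 : -f t / (2 * (1 + (t - a))) * (1 + (t - a)) = -f t / 2 := by field_simp
  linarith

/-- Comparison principle along an orbit. -/
lemma comparison {b : ℝ → ℝ} (hb0 : ∀ z, 0 ≤ b z) (hbK : ∀ Z, ∃ K, ∀ z ≤ Z, b z ≤ K)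
    {L : ℝ} (hL : 0 < L) {p q : ℝ} (hp : 0 < p) (hq : 0 < q)
    (S : Set ℝ) (hS : ∀ z ∈ S, z - L ∈ S) (D d : ℝ → ℝ → ℝ)
    (cont : ∀ z ∈ S, ContinuousOn (fun t => D t z) (Ici 0))
    (der : ∀ z ∈ S, ∀ t ≥ 0, HasDerivWithinAt (fun t => D t z) (d t z) (Ici t) t)
    (ineq : ∀ z ∈ S, ∀ t ≥ 0, b (z - t) * (D t (z - L) - D t z) ≤ d t z)
    (bdd : ∀ r > 0, ∃ C, ∀ t, 0 ≤ t → t ≤ r → ∀ z ∈ S, -(C * VV p q (z - t)) ≤ D t z)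
    (h0 : ∀ z ∈ S, 0 ≤ D 0 z) : ∀ z ∈ S, ∀ t ≥ 0, 0 ≤ D t z := by
  intro z₀ hz₀ T hT
  rcases hT.eq_or_lt with rfl | hT
  · exact h0 z₀ hz₀
  have hT' : 0 < T := hT
  obtain ⟨K, hK⟩ := hbK z₀
  have hK0 : 0 ≤ K := (hb0 z₀).trans (hK z₀ le_rfl)
  obtain ⟨C, hC⟩ := bdd T hT'
  set κ := K * exp ((p + 1) * L) with hκ
  have key : ∀ ε > 0, 0 ≤ D T z₀ + ε * exp (κ * T) * exp (-(p + 1) * z₀) := by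
    intro ε hε
    have hSn : ∀ n : ℕ, z₀ - n * L ∈ S := by
      intro n
      induction n with
      | zero => simpa using hz₀
      | succ n ih => have := hS _ ih; convert this using 1; push_cast; ring
    have claim1 : ∀ᶠ n : ℕ in atTop, ∀ t ∈ Icc 0 T, 0 ≤ D t (z₀ - n * L) + ε * exp (κ * t) *
        exp (-(p + 1) * (z₀ - n * L)) := by
      have lim : Tendsto (fun z : ℝ => |C| * (exp (p * T) * exp z + exp (q * z₀) * exp ((p+1) * z)))
          atBot (𝓝 (|C| * (exp (p * T) * 0 + exp (q * z₀) * 0))) := by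
        have h1 := tendsto_exp_atBot
        have h2 : Tendsto (fun z : ℝ => exp ((p+1) * z)) atBot (𝓝 0) :=
          tendsto_exp_atBot.comp (tendsto_id.const_mul_atBot (by linarith))
        exact ((h1.const_mul _).add (h2.const_mul _)).const_mul _
      have lim2 : Tendsto (fun n : ℕ => z₀ - n * L) atTop atBot := by
        have : Tendsto (fun n : ℕ => (n:ℝ) * L) atTop atTop :=
          tendsto_natCast_atTop_atTop.atTop_mul_const hL
        exact tendsto_atBot_add_const_left _ z₀ (tendsto_neg_atTop_atBot.comp this)
      have lim3 := lim.comp lim2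
      have := lim3.eventually_lt_const (u := ε) (by simpa using hε)
      filter_upwards [this] with n hn t ht
      set z := z₀ - n * L with hz
      have hzle : z ≤ z₀ := by rw [hz]; have : (0:ℝ) ≤ n * L := by positivity
                               linarith
      have h1 := hC t ht.1 ht.2 z (hSn n)
      simp only [Function.comp] at hn
      rw [← hz] at hn
      have hV : VV p q (z - t) ≤ exp (p * T) * exp (-p * z) + exp (q * z₀) := by
        unfold VV
        rw [← exp_add]
        have := ht.1
        have := ht.2
        gcongr
        · nlinarith
        · nlinarith
      have h2 : C * VV p q (z - t) ≤ |C| * (exp (p * T) * exp (-p * z) + exp (q * z₀)) :=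
        (mul_le_mul_of_nonneg_right (le_abs_self C) (VV_pos _ _ _).le).trans
          (mul_le_mul_of_nonneg_left hV (abs_nonneg _))
      have h3 : |C| * (exp (p * T) * exp (-p * z) + exp (q * z₀)) =
          |C| * (exp (p * T) * exp z + exp (q * z₀) * exp ((p+1) * z)) * exp (-(p+1) * z) := by
        have e1 : exp (-p * z) = exp z * exp (-(p+1) * z) := by rw [← exp_add]; ring_nf
        have e2 : 1 = exp ((p+1) * z) * exp (-(p+1) * z) := by
          rw [← exp_add, ← exp_zero]; ring_nf
        rw [e1]
        linear_combination |C| * exp (q * z₀) * e2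
      have h4 : 1 ≤ exp (κ * t) := one_le_exp (mul_nonneg (by positivity) ht.1)
      have h5 := exp_pos (-(p+1) * z)
      have h6 : ε * exp (-(p+1) * z) ≤ ε * exp (κ * t) * exp (-(p+1) * z) := by
        have : ε * 1 ≤ ε * exp (κ * t) := by gcongr
        nlinarith
      have h7 : |C| * (exp (p * T) * exp z + exp (q * z₀) * exp ((p+1) * z)) * exp (-(p+1) * z) ≤
        ε * exp (-(p+1) * z) := by gcongr
      linarith
    obtain ⟨N, hN⟩ := claim1.exists
    have step : ∀ n : ℕ, (∀ t ∈ Icc 0 T, 0 ≤ D t (z₀ - (n+1:ℕ) * L) + ε * exp (κ * t) *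
        exp (-(p + 1) * (z₀ - (n+1:ℕ) * L))) → (∀ t ∈ Icc 0 T, 0 ≤ D t (z₀ - n * L) +
        ε * exp (κ * t) * exp (-(p + 1) * (z₀ - n * L))) := by
      intro n ih
      set z := z₀ - n * L with hz
      have hzle : z ≤ z₀ := by rw [hz]; have : (0:ℝ) ≤ n * L := by positivity
                               linarith
      have hz' : z₀ - (n+1:ℕ) * L = z - L := by rw [hz]; push_cast; ring
      rw [hz'] at ih
      have hzS : z ∈ S := hSn n
      refine pos1d _ (fun t => d t z + κ * (ε * exp (κ * t) * exp (-(p+1) * z))) 0 T ?_ ?_ ?_ ?_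
      · refine ContinuousOn.add ((cont z hzS).mono Icc_subset_Ici_self) ?_
        fun_prop
      · intro t ht
        refine (der z hzS t ht.1).add ?_
        have := ((((hasDerivAt_id t).const_mul κ).exp).const_mul ε).mul_const (exp (-(p+1) * z))
        simp only [id] at this
        convert this.hasDerivWithinAt using 1
        ring
      · have := h0 z hzS
        positivity
      · intro t ht hneg
        have h1 := ineq z hzS t ht.1
        have h2 := ih t ⟨ht.1, ht.2.le⟩
        have e1 : exp (-(p + 1) * (z - L)) = exp ((p+1) * L) * exp (-(p+1) * z) := by
          rw [← exp_add]; ring_nf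
        rw [e1] at h2
        have hbz := hb0 (z - t)
        have hbz' : b (z - t) ≤ K := hK _ (by linarith [ht.1])
        set θ := ε * exp (κ * t) * exp (-(p+1) * z) with hθ
        have hθ0 : 0 < θ := by positivity
        have h3 : -(exp ((p+1) * L) * θ) ≤ D t (z - L) - D t z := by
          have : ε * exp (κ * t) * (exp ((p+1) * L) * exp (-(p+1) * z)) = exp ((p+1) * L) * θ := by
            rw [hθ]; ring
          linarith
        have h4 : -(K * (exp ((p+1) * L) * θ)) ≤ b (z - t) * (D t (z - L) - D t z) := by
          calc -(K * (exp ((p+1) * L) * θ)) ≤ b (z - t) * (-(exp ((p+1) * L) * θ)) := by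
                have : 0 < exp ((p+1) * L) * θ := by positivity
                nlinarith
            _ ≤ _ := by gcongr
        have : κ * θ = K * (exp ((p+1) * L) * θ) := by rw [hκ]; ring
        linarith
    have all : ∀ k : ℕ, k ≤ N → (∀ t ∈ Icc 0 T, 0 ≤ D t (z₀ - (N - k : ℕ) * L) +
        ε * exp (κ * t) * exp (-(p + 1) * (z₀ - (N - k : ℕ) * L))) := by
      intro k
      induction k with
      | zero => intro _; simpa using hN
      | succ k ih =>
        intro hk
        apply step
        have : N - (k+1) + 1 = N - k := by omega
        rw [this]
        exact ih (by omega)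
    have := all N le_rfl T ⟨hT'.le, le_rfl⟩
    simpa using this
  by_contra hcon
  push Not at hcon
  set A := exp (κ * T) * exp (-(p + 1) * z₀) with hA
  have hA0 : 0 < A := by positivity
  have := key (-D T z₀ / (2 * A)) (by apply div_pos <;> linarith)
  have h3 : -D T z₀ / (2 * A) * exp (κ * T) * exp (-(p + 1) * z₀) = -D T z₀ / 2 := by
    rw [mul_assoc, ← hA]; field_simp
  linarith

structure SuperSol (b : ℝ → ℝ) (L : ℝ) (S : Set ℝ) (D d : ℝ → ℝ → ℝ) : Prop where
  cont : ∀ z ∈ S, ContinuousOn (fun t => D t z) (Ici 0)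
  der : ∀ z ∈ S, ∀ t ≥ 0, HasDerivWithinAt (fun t => D t z) (d t z) (Ici t) t
  ineq : ∀ z ∈ S, ∀ t ≥ 0, b (z - t) * (D t (z - L) - D t z) ≤ d t z

structure SolLine (b : ℝ → ℝ) (L p q : ℝ) (l : ℝ → ℝ → ℝ) : Prop where
  cont : ∀ z, ContinuousOn (fun t => l t z) (Ici 0)
  der : ∀ z, ∀ t ≥ 0, HasDerivWithinAt (fun t => l t z) (b (z - t) * (l t (z - L) - l t z)) (Ici t) t
  bdd : ∀ r > 0, ∃ C, ∀ t, 0 ≤ t → t ≤ r → ∀ z, |l t z| ≤ C * VV p q (z - t)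

lemma SolLine.shift {b : ℝ → ℝ} {L p q : ℝ} {l : ℝ → ℝ → ℝ} (h : SolLine b L p q l) (s : ℝ)
    (hs : 0 ≤ s) : SolLine b L p q (fun t z => l (s + t) (z + s)) := by
  refine ⟨?_, ?_, ?_⟩
  · intro z
    refine (h.cont (z + s)).comp (by fun_prop) ?_
    intro t ht
    simp only [mem_Ici] at *
    linarith
  · intro z t ht
    have h1 := h.der (z + s) (s + t) (by linarith)
    have h2 : HasDerivWithinAt (fun t => s + t) 1 (Ici t) t :=
      ((hasDerivAt_id t).const_add s).hasDerivWithinAt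
    have h3 := HasDerivWithinAt.comp t h1 h2 (s' := Ici (s + t)) (by
      intro x hx; simp only [mem_Ici] at *; linarith)
    rw [mul_one] at h3
    refine HasDerivWithinAt.congr_deriv (f := fun t => l (s + t) (z + s)) h3 ?_
    have e1 : z + s - (s + t) = z - t := by ring
    have e2 : z - L + s = z + s - L := by ring
    rw [e1, e2]
  · intro r hr
    obtain ⟨C, hC⟩ := h.bdd (s + r) (by linarith)
    refine ⟨C, fun t ht htr z => ?_⟩
    have := hC (s + t) (by linarith) (by linarith) (z + s)
    have e1 : z + s - (s + t) = z - t := by ring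
    rwa [e1] at this

/-- Evolved Lyapunov function. -/
def SS (p q c K t z : ℝ) : ℝ := exp (-c * t) * VV p q (z - t) + K / c * (1 - exp (-c * t))

def SS' (p q c K t z : ℝ) : ℝ :=
  -c * exp (-c * t) * VV p q (z - t)
    - exp (-c * t) * (-p * exp (-p * (z - t)) + q * exp (q * (z - t))) + K * exp (-c * t)

lemma SS_hasDeriv (p q c K t z : ℝ) (hc : 0 < c) :
    HasDerivAt (fun t => SS p q c K t z) (SS' p q c K t z) t := by
  unfold SS SS' VV
  have h1 : HasDerivAt (fun t => exp (-c * t)) (exp (-c * t) * -c) t := by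
    have := ((hasDerivAt_id t).const_mul (-c)).exp
    simpa using this
  have h0 : HasDerivAt (fun t => z - t) (-1) t := by
    simpa using (hasDerivAt_id t).const_sub z
  have h2 : HasDerivAt (fun t => exp (-p * (z - t))) (exp (-p * (z - t)) * (-p * -1)) t :=
    (h0.const_mul (-p)).exp
  have h3 : HasDerivAt (fun t => exp (q * (z - t))) (exp (q * (z - t)) * (q * -1)) t :=
    (h0.const_mul q).exp
  have := (h1.mul (h2.add h3)).add ((h1.const_sub 1).const_mul (K / c))
  refine HasDerivAt.congr_deriv this ?_
  simp only [Pi.add_apply]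
  field_simp
  ring

/-- Lyapunov inequality. -/
def Lyap (b : ℝ → ℝ) (L p q c K : ℝ) : Prop :=
  ∀ z, (-p * exp (-p * z) + q * exp (q * z)) + b z * (VV p q (z - L) - VV p q z)
    ≤ -c * VV p q z + K

lemma SS_ineq {b : ℝ → ℝ} {L p q c K : ℝ} (h : Lyap b L p q c K) (t z : ℝ) :
    b (z - t) * (SS p q c K t (z - L) - SS p q c K t z) ≤ SS' p q c K t z := by
  have h1 := h (z - t)
  unfold SS SS'
  have e1 : z - L - t = z - t - L := by ring
  rw [e1]
  have h2 := mul_le_mul_of_nonneg_left h1 (exp_pos (-c * t)).le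
  nlinarith

/-- `E + A*SS ± l` is a supersolution. -/
lemma super_combo {b : ℝ → ℝ} {L p q c K : ℝ} (hc : 0 < c) (hLy : Lyap b L p q c K)
    {l : ℝ → ℝ → ℝ} (h : SolLine b L p q l) (S : Set ℝ) (E A σ : ℝ) (hA : 0 ≤ A) :
    SuperSol b L S (fun t z => E + A * SS p q c K t z + σ * l t z)
      (fun t z => A * SS' p q c K t z + σ * (b (z - t) * (l t (z - L) - l t z))) := by
  refine ⟨?_, ?_, ?_⟩
  · intro z _
    have h1 : Continuous (fun t => SS p q c K t z) :=
      continuous_iff_continuousAt.2 fun t => (SS_hasDeriv p q c K t z hc).continuousAt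
    exact ((continuous_const.add (h1.const_mul A)).continuousOn).add ((h.cont z).const_mul σ)
  · intro z _ t ht
    exact ((((SS_hasDeriv p q c K t z hc).const_mul A).const_add E).hasDerivWithinAt).add
      ((h.der z t ht).const_mul σ)
  · intro z _ t ht
    have := mul_le_mul_of_nonneg_left (SS_ineq hLy t z) hA
    nlinarith

lemma SS_le {p q c K t z : ℝ} (hc : 0 < c) (hK : 0 ≤ K) :
    SS p q c K t z ≤ exp (-c * t) * VV p q (z - t) + K / c := by
  unfold SS
  have := exp_pos (-c * t)
  have h2 : 0 ≤ K / c := by positivity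
  nlinarith

lemma SS_nonneg {p q c K t z : ℝ} (hc : 0 < c) (hK : 0 ≤ K) (ht : 0 ≤ t) :
    0 ≤ SS p q c K t z := by
  unfold SS
  have h1 : exp (-c * t) ≤ 1 := exp_le_one_iff.2 (by nlinarith)
  have h2 : 0 ≤ K / c := by positivity
  have := VV_pos p q (z - t)
  have := exp_pos (-c * t)
  have : 0 ≤ K / c * (1 - exp (-c * t)) := mul_nonneg h2 (by linarith)
  positivity

lemma SS_zero (p q c K z : ℝ) : SS p q c K 0 z = VV p q z := by simp [SS]

lemma super_combo_nonneg {b : ℝ → ℝ} (hb0 : ∀ z, 0 ≤ b z) (hbK : ∀ Z, ∃ K, ∀ z ≤ Z, b z ≤ K)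
    {L : ℝ} (hL : 0 < L) {p q : ℝ} (hp : 0 < p) (hq : 0 < q) {c K : ℝ} (hc : 0 < c) (hK : 0 ≤ K)
    (hLy : Lyap b L p q c K)
    {l : ℝ → ℝ → ℝ} (h : SolLine b L p q l) (S : Set ℝ) (hS : ∀ z ∈ S, z - L ∈ S)
    (E A σ : ℝ) (hA : 0 ≤ A) (h0 : ∀ z ∈ S, 0 ≤ E + A * VV p q z + σ * l 0 z) :
    ∀ z ∈ S, ∀ t ≥ 0, 0 ≤ E + A * SS p q c K t z + σ * l t z := by
  have hs := super_combo hc hLy h S E A σ hA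
  refine comparison hb0 hbK hL hp hq S hS _ _ hs.cont hs.der hs.ineq ?_ ?_
  · intro r hr
    obtain ⟨C, hC⟩ := h.bdd r hr
    refine ⟨|E| + |σ| * C, fun t ht htr z _ => ?_⟩
    have h1 := hC t ht htr z
    have h2 : 0 ≤ A * SS p q c K t z := mul_nonneg hA (SS_nonneg hc hK ht)
    have h3 := VV_ge_one hp hq (z - t)
    have h4 : |σ * l t z| ≤ |σ| * (C * VV p q (z - t)) := by rw [abs_mul]; gcongr
    have h5 : |E| * 1 ≤ |E| * VV p q (z - t) := by gcongr
    have h6 := (abs_le.1 h4).1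
    have h7 := neg_abs_le E
    show _ ≤ E + A * SS p q c K t z + σ * l t z
    nlinarith
  · intro z hz
    have := h0 z hz
    simpa [SS_zero] using this

lemma lyap_bound {b : ℝ → ℝ} (hb0 : ∀ z, 0 ≤ b z) (hbK : ∀ Z, ∃ K, ∀ z ≤ Z, b z ≤ K)
    {L : ℝ} (hL : 0 < L) {p q : ℝ} (hp : 0 < p) (hq : 0 < q) {c K : ℝ} (hc : 0 < c) (hK : 0 ≤ K)
    (hLy : Lyap b L p q c K)
    {l : ℝ → ℝ → ℝ} (h : SolLine b L p q l) (A : ℝ) (hA : 0 ≤ A)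
    (h0 : ∀ z, |l 0 z| ≤ A * VV p q z) :
    ∀ z, ∀ t ≥ 0, |l t z| ≤ A * (VV p q (z - t) + K / c) := by
  intro z t ht
  have h1 := super_combo_nonneg hb0 hbK hL hp hq hc hK hLy h univ (by simp) 0 A 1 hA
    (fun z _ => by have := (abs_le.1 (h0 z)).1; linarith) z (mem_univ _) t ht
  have h2 := super_combo_nonneg hb0 hbK hL hp hq hc hK hLy h univ (by simp) 0 A (-1) hA
    (fun z _ => by have := (abs_le.1 (h0 z)).2; linarith) z (mem_univ _) t ht
  have h3 : A * SS p q c K t z ≤ A * (exp (-c * t) * VV p q (z - t) + K / c) :=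
    mul_le_mul_of_nonneg_left (SS_le hc hK) hA
  have h4 : exp (-c * t) ≤ 1 := exp_le_one_iff.2 (by nlinarith)
  have h5 : exp (-c * t) * VV p q (z - t) ≤ 1 * VV p q (z - t) := by
    have := VV_pos p q (z - t); gcongr
  have h6 : A * (exp (-c * t) * VV p q (z - t) + K / c) ≤ A * (VV p q (z - t) + K / c) := by
    gcongr; linarith
  rw [abs_le]
  constructor <;> linarith

/-- The orbit of a point. -/
def orb (L z₀ : ℝ) : Set ℝ := {z | ∃ k : ℤ, z = z₀ + k * L}

lemma orb_sub {L z₀ z : ℝ} (h : z ∈ orb L z₀) : z - L ∈ orb L z₀ := by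
  obtain ⟨k, rfl⟩ := h
  exact ⟨k - 1, by push_cast; ring⟩

lemma minor {b : ℝ → ℝ} (hb0 : ∀ z, 0 ≤ b z) (hbK : ∀ Z, ∃ K, ∀ z ≤ Z, b z ≤ K)
    (hbinf : Tendsto b atTop atTop)
    {L : ℝ} (hL : 0 < L) (ρ T₀ : ℝ) :
    ∃ T, T₀ ≤ T ∧ 0 < T ∧ ∃ α > 0, α ≤ 1 ∧ ∃ Z, ∀ z₀ ∈ Icc Z (Z + L), ∀ D d : ℝ → ℝ → ℝ,
      SuperSol b L (orb L z₀) D d → (∀ z ∈ orb L z₀, ∀ t ≥ 0, 0 ≤ D t z) →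
      ∀ k : ℤ, |z₀ + k * L - T| ≤ ρ → α * D 0 z₀ ≤ D T (z₀ + k * L) := by
  obtain ⟨Z', hZ'⟩ := eventually_atTop.1 (hbinf.eventually_ge_atTop 1)
  set Z := Z' + 1 with hZ
  set T := max (max T₀ 1) (Z + L + ρ) with hT
  have hT0 : T₀ ≤ T := (le_max_left _ _).trans (le_max_left _ _)
  have hT1 : 1 ≤ T := (le_max_right _ _).trans (le_max_left _ _)
  have hT2 : Z + L + ρ ≤ T := le_max_right _ _
  obtain ⟨M₀, hM₀⟩ := hbK (T + ρ)
  set M := max M₀ 0 with hMdef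
  have hM : ∀ z ≤ T + ρ, b z ≤ M := fun z hz => (hM₀ z hz).trans (le_max_left _ _)
  have hM0 : 0 ≤ M := le_max_right _ _
  obtain ⟨N, hN⟩ := exists_nat_ge ((T + ρ - Z) / L)
  set a : ℝ := 1 / (N + 1) with ha
  have ha0 : 0 < a := by positivity
  have ha1 : a ≤ 1 := by rw [ha, div_le_one (by positivity)]; linarith [(Nat.cast_nonneg N : (0:ℝ) ≤ N)]
  refine ⟨T, hT0, by linarith, a ^ N * exp (-(M * T)), by positivity, ?_, Z, ?_⟩
  · have h1 : a ^ N ≤ 1 := pow_le_one₀ ha0.le ha1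
    have h2 : exp (-(M * T)) ≤ 1 := exp_le_one_iff.2 (by nlinarith)
    calc _ ≤ (1:ℝ) * 1 := by gcongr
      _ = 1 := by ring
  intro z₀ hz₀ D d hD hDn k hk
  have hk' := abs_le.1 hk
  have hk0 : 0 ≤ k := by
    by_contra hneg
    push Not at hneg
    have h1 : (k:ℝ) ≤ -1 := by exact_mod_cast (by omega : k ≤ -1)
    have h2 : (k:ℝ) * L ≤ -1 * L := by gcongr
    linarith [hz₀.2]
  obtain ⟨n, rfl⟩ := Int.eq_ofNat_of_zero_le hk0
  simp only [Int.cast_natCast] at *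
  have hnN : n ≤ N := by
    have : (n:ℝ) ≤ (T + ρ - Z) / L := by
      rw [le_div_iff₀ hL]; linarith [hz₀.1]
    exact_mod_cast this.trans hN
  have hmem : ∀ j : ℕ, z₀ + j * L ∈ orb L z₀ := fun j => ⟨j, by simp⟩
  have hle : ∀ j : ℕ, j ≤ n → ∀ t ≥ 0, b (z₀ + j * L - t) ≤ M := by
    intro j hj t ht
    apply hM
    have : (j:ℝ) * L ≤ n * L := by gcongr
    linarith
  have hexp : ∀ t, HasDerivAt (fun t => exp (M * t)) (M * exp (M * t)) t := by
    intro t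
    have := ((hasDerivAt_id t).const_mul M).exp
    simp only [id, mul_one] at this
    rwa [mul_comm (M) (exp _)]
  have hexpc : Continuous (fun t => exp (M * t)) := by fun_prop
  have claim : ∀ j : ℕ, j ≤ n → ∀ t ∈ Icc (0:ℝ) 1,
      0 ≤ D t (z₀ + j * L) * exp (M * t) - (t * a) ^ j * D 0 z₀ := by
    intro j
    induction j with
    | zero =>
      intro _
      refine pos1d _ (fun t => d t (z₀ + (0:ℕ) * L) * exp (M * t) + D t (z₀ + (0:ℕ) * L) * (M * exp (M * t)))
        0 1 ?_ ?_ ?_ ?_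
      · refine ContinuousOn.sub ?_ (by fun_prop)
        exact ((hD.cont _ (hmem 0)).mono Icc_subset_Ici_self).mul hexpc.continuousOn
      · intro t ht
        have := ((hD.der _ (hmem 0) t ht.1).mul (hexp t).hasDerivWithinAt).sub_const (D 0 z₀)
        simpa using this
      · simp
      · intro t ht _
        have h1 := hD.ineq _ (hmem 0) t ht.1
        have h2 := hle 0 (by omega) t ht.1
        have h3 := hDn _ (hmem 0) t ht.1
        have h4 := hDn _ (orb_sub (hmem 0)) t ht.1
        have h5 := hb0 (z₀ + (0:ℕ) * L - t)
        have : 0 ≤ d t (z₀ + (0:ℕ) * L) + D t (z₀ + (0:ℕ) * L) * M := by nlinarith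
        have := mul_nonneg this (exp_pos (M * t)).le
        linarith
    | succ j ih =>
      intro hj
      have ih := ih (by omega)
      refine pos1d _ (fun t => (d t (z₀ + (j+1:ℕ) * L) * exp (M * t) +
        D t (z₀ + (j+1:ℕ) * L) * (M * exp (M * t))) - ((j+1:ℕ) * (t * a) ^ j * a) * D 0 z₀)
        0 1 ?_ ?_ ?_ ?_
      · refine ContinuousOn.sub ?_ (by fun_prop)
        exact ((hD.cont _ (hmem (j+1))).mono Icc_subset_Ici_self).mul hexpc.continuousOn
      · intro t ht
        have h1 : HasDerivAt (fun t => (t * a) ^ (j+1)) ((j+1:ℕ) * (t * a) ^ j * a) t := by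
          have := ((hasDerivAt_id t).mul_const a).fun_pow (j+1)
          simpa using this
        exact ((hD.der _ (hmem (j+1)) t ht.1).mul (hexp t).hasDerivWithinAt).sub
          (h1.mul_const (D 0 z₀)).hasDerivWithinAt
      · have := hDn _ (hmem (j+1)) 0 le_rfl
        simpa using this
      · intro t ht _
        have h1 := hD.ineq _ (hmem (j+1)) t ht.1
        have h2 := hle (j+1) (by omega) t ht.1
        have h3 := hDn _ (hmem (j+1)) t ht.1
        have h4 := hDn _ (orb_sub (hmem (j+1))) t ht.1
        have e1 : z₀ + (j+1:ℕ) * L - L = z₀ + j * L := by push_cast; ring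
        rw [e1] at h1 h4
        have h5 : 1 ≤ b (z₀ + (j+1:ℕ) * L - t) := by
          apply hZ'
          have : (0:ℝ) ≤ (j+1:ℕ) * L := by positivity
          linarith [ht.2, hz₀.1]
        have h6 : D t (z₀ + j * L) ≤ d t (z₀ + (j+1:ℕ) * L) + D t (z₀ + (j+1:ℕ) * L) * M := by
          nlinarith
        have h7 := mul_le_mul_of_nonneg_right h6 (exp_pos (M * t)).le
        have h8 := ih t ⟨ht.1, ht.2.le⟩
        have h9 : ((j+1:ℕ):ℝ) * a ≤ 1 := by
          rw [ha, mul_one_div, div_le_one (by positivity)]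
          have : j + 1 ≤ N := by omega
          have : ((j+1:ℕ):ℝ) ≤ N := by exact_mod_cast this
          linarith
        have h10 := hDn _ (hmem 0) 0 le_rfl
        simp only [Nat.cast_zero, zero_mul, add_zero] at h10
        have h11 : 0 ≤ (t * a) ^ j * D 0 z₀ := by have := ht.1; positivity
        have h12 := mul_le_mul_of_nonneg_right h9 h11
        have e2 : ((j+1:ℕ):ℝ) * (t * a) ^ j * a * D 0 z₀ = ((j+1:ℕ):ℝ) * a * ((t * a) ^ j * D 0 z₀) := by
          ring
        rw [e2]
        linarith
  have c1 := claim n le_rfl 1 ⟨by norm_num, le_rfl⟩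
  have c2 : 0 ≤ D T (z₀ + n * L) * exp (M * T) - D 1 (z₀ + n * L) * exp (M * 1) := by
    refine pos1d (fun t => D t (z₀ + n * L) * exp (M * t) - D 1 (z₀ + n * L) * exp (M * 1))
      (fun t => d t (z₀ + n * L) * exp (M * t) + D t (z₀ + n * L) * (M * exp (M * t)))
        1 T ?_ ?_ ?_ ?_ T ⟨hT1, le_rfl⟩
    · refine ContinuousOn.sub ?_ (by fun_prop)
      refine ((hD.cont _ (hmem n)).mono ?_).mul hexpc.continuousOn
      intro t ht
      simp only [mem_Ici]
      linarith [ht.1]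
    · intro t ht
      have ht0 : 0 ≤ t := by linarith [ht.1]
      exact ((hD.der _ (hmem n) t ht0).mul (hexp t).hasDerivWithinAt).sub_const _
    · simp
    · intro t ht _
      have ht0 : 0 ≤ t := by linarith [ht.1]
      have h1 := hD.ineq _ (hmem n) t ht0
      have h2 := hle n le_rfl t ht0
      have h3 := hDn _ (hmem n) t ht0
      have h4 := hDn _ (orb_sub (hmem n)) t ht0
      have h5 := hb0 (z₀ + n * L - t)
      have : 0 ≤ d t (z₀ + n * L) + D t (z₀ + n * L) * M := by nlinarith
      have := mul_nonneg this (exp_pos (M * t)).le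
      linarith
  have h10 := hDn _ (hmem 0) 0 le_rfl
  simp only [Nat.cast_zero, zero_mul, add_zero] at h10
  have c3 : a ^ N * D 0 z₀ ≤ D T (z₀ + n * L) * exp (M * T) := by
    have : a ^ N ≤ a ^ n := pow_le_pow_of_le_one ha0.le ha1 hnN
    have := mul_le_mul_of_nonneg_right this h10
    rw [one_mul] at c1
    linarith
  have c4 := mul_le_mul_of_nonneg_right c3 (exp_pos (-(M * T))).le
  rw [mul_assoc (D T _), ← exp_add, add_neg_cancel, exp_zero, mul_one] at c4
  linarith

lemma exists_lyap {b : ℝ → ℝ} (hbc : Continuous b) (hb0 : ∀ z, 0 ≤ b z)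
    (hbot : Tendsto b atBot (𝓝 0)) (hbinf : Tendsto b atTop atTop)
    {L : ℝ} (hL : 0 < L) {p q : ℝ} (hp : 0 < p) (hq : 0 < q) :
    ∃ c > 0, ∃ K > 0, Lyap b L p q c K := by
  set c := p / 2 with hc
  have hc0 : 0 < c := by positivity
  set P := exp (p * L) - 1 with hP
  set Q := 1 - exp (-(q * L)) with hQ
  have hP0 : 0 < P := by have : 1 < exp (p * L) := one_lt_exp_iff.2 (by positivity)
                         linarith
  have hQ0 : 0 < Q := by have : exp (-(q * L)) < 1 := exp_lt_one_iff.2 (by nlinarith)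
                         linarith
  have hVd : ∀ z, VV p q (z - L) - VV p q z = P * exp (-p * z) - Q * exp (q * z) := by
    intro z
    unfold VV
    have e1 : exp (-p * (z - L)) = exp (p * L) * exp (-p * z) := by rw [← exp_add]; ring_nf
    have e2 : exp (q * (z - L)) = exp (-(q * L)) * exp (q * z) := by rw [← exp_add]; ring_nf
    rw [e1, e2, hP, hQ]; ring
  set Λ : ℝ → ℝ := fun z => (-p * exp (-p * z) + q * exp (q * z)) +
    b z * (VV p q (z - L) - VV p q z) + c * VV p q z with hΛ
  have hΛc : Continuous Λ := by
    rw [hΛ]; unfold VV; fun_prop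
  have h1 : ∀ᶠ z in atBot, Λ z ≤ q + c := by
    have := hbot.eventually_lt_const (u := p / 2 / P) (by positivity)
    filter_upwards [this, eventually_le_atBot 0] with z hz hz0
    simp only [hΛ, hVd]
    unfold VV
    have h2 : b z * P ≤ p / 2 := by rw [lt_div_iff₀ hP0] at hz; exact hz.le
    have h3 : exp (q * z) ≤ 1 := exp_le_one_iff.2 (by nlinarith)
    have h4 := exp_pos (q * z)
    have h5 := exp_pos (-p * z)
    have h6 : 0 ≤ b z * (Q * exp (q * z)) := mul_nonneg (hb0 z) (by positivity)
    have h7 := mul_le_mul_of_nonneg_right h2 h5.le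
    have h8 : (q + c) * exp (q * z) ≤ (q + c) * 1 := by gcongr
    rw [hc] at *
    nlinarith
  have h2 : ∀ᶠ z in atTop, Λ z ≤ q + c := by
    have l1 : Tendsto (fun z : ℝ => exp (-p * z) * P) atTop (𝓝 (0 * P)) := by
      refine Tendsto.mul_const _ (tendsto_exp_atBot.comp ?_)
      exact tendsto_id.const_mul_atTop_of_neg (by linarith)
    have e1 := l1.eventually_lt_const (u := Q / 2) (by simpa using hQ0)
    have e2 := hbinf.eventually_ge_atTop (2 * (q + c) / Q)
    filter_upwards [e1, e2, eventually_ge_atTop 0] with z hz1 hz2 hz0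
    simp only [hΛ, hVd]
    unfold VV
    have h3 : 1 ≤ exp (q * z) := one_le_exp (by positivity)
    have h5 := exp_pos (-p * z)
    have h6 : P * exp (-p * z) - Q * exp (q * z) ≤ -(Q / 2 * exp (q * z)) := by nlinarith
    have h7 := mul_le_mul_of_nonneg_left h6 (hb0 z)
    have h8 : q + c ≤ b z * (Q / 2) := by
      rw [div_le_iff₀ hQ0] at hz2; linarith
    have h9 := mul_le_mul_of_nonneg_right h8 (by linarith : 0 ≤ exp (q * z))
    have h10 : 0 ≤ (p - c) * exp (-p * z) := mul_nonneg (by rw [hc]; linarith) h5.le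
    nlinarith
  obtain ⟨z1, hz1⟩ := eventually_atBot.1 h1
  obtain ⟨z2, hz2⟩ := eventually_atTop.1 h2
  obtain ⟨K0, hK0⟩ := (isCompact_Icc (a := z1) (b := z2)).bddAbove_image hΛc.continuousOn
  refine ⟨c, hc0, max K0 (q + c), lt_max_of_lt_right (by positivity), fun z => ?_⟩
  have : Λ z ≤ max K0 (q + c) := by
    rcases le_total z z1 with h | h
    · exact (hz1 z h).trans (le_max_right _ _)
    · rcases le_total z2 z with h' | h'
      · exact (hz2 z h').trans (le_max_right _ _)
      · exact (hK0 ⟨z, ⟨h, h'⟩, rfl⟩).trans (le_max_left _ _)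
  simp only [hΛ] at this
  linarith

lemma VV_sublevel {p q : ℝ} (hp : 0 < p) (hq : 0 < q) (R : ℝ) :
    ∃ ρ, ∀ z, VV p q z ≤ R → |z| ≤ ρ := by
  refine ⟨max (R / p) (R / q), fun z hz => ?_⟩
  unfold VV at hz
  have h1 := add_one_le_exp (-p * z)
  have h2 := add_one_le_exp (q * z)
  have h3 := exp_pos (-p * z)
  have h4 := exp_pos (q * z)
  rw [abs_le']
  constructor
  · refine le_trans ?_ (le_max_right _ _)
    rw [le_div_iff₀ hq]; linarith
  · refine le_trans ?_ (le_max_left _ _)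
    rw [le_div_iff₀ hp]; linarith

/-- oscillation along orbits at time `0` -/
def Osc (L p q β : ℝ) (l : ℝ → ℝ → ℝ) (A : ℝ) : Prop :=
  ∀ z, ∀ k : ℤ, l 0 z - l 0 (z + k * L) ≤ A * (2 + β * VV p q z + β * VV p q (z + k * L))

lemma contraction {b : ℝ → ℝ} (hb0 : ∀ z, 0 ≤ b z) (hbK : ∀ Z, ∃ K, ∀ z ≤ Z, b z ≤ K)
    (hbinf : Tendsto b atTop atTop)
    {L : ℝ} (hL : 0 < L) {p q : ℝ} (hp : 0 < p) (hq : 0 < q) {c K : ℝ} (hc : 0 < c) (hK : 0 < K)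
    (hLy : Lyap b L p q c K) :
    ∃ T > 0, ∃ β > 0, ∃ α, 0 < α ∧ α < 1 ∧ ∀ l, SolLine b L p q l → ∀ A, 0 ≤ A →
      Osc L p q β l A → Osc L p q β (fun t z => l (T + t) (z + T)) (α * A) := by
  set K' := K / c with hK'
  have hK'0 : 0 < K' := by positivity
  obtain ⟨ρ, hρ⟩ := VV_sublevel hp hq (8 * K')
  obtain ⟨T, hT0, hT, α, hα, hα1, Z, hmin⟩ := minor hb0 hbK hbinf hL ρ (log 2 / c)
  set β := α / (2 * K') with hβ
  have hβ0 : 0 < β := by positivity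
  have hβK : 2 * (β * K') = α := by rw [hβ]; field_simp
  set η := α / 8 with hη
  have hexpT : exp (-c * T) ≤ 1 / 2 := by
    rw [div_le_iff₀ hc] at hT0
    have : exp (-c * T) ≤ exp (-log 2) := exp_le_exp.2 (by linarith)
    rwa [exp_neg, exp_log (by norm_num), ← one_div] at this
  refine ⟨T, hT, β, hβ0, 1 - η, by rw [hη]; linarith, by rw [hη]; linarith, ?_⟩
  intro l hl A hA hosc z1 k
  set z := z1 + T with hz
  have ez' : z1 + k * L + T = z + k * L := by rw [hz]; ring
  have ez1 : z1 = z - T := by rw [hz]; ring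
  simp only [add_zero]
  rw [ez', ← hz, ez1]
  have ez2 : z - T + k * L = z + k * L - T := by ring
  rw [ez2]
  -- orbit representative
  set j := ⌊(z - Z) / L⌋ with hj
  set z₀ := z - j * L with hz₀
  have hz₀m : z₀ ∈ Icc Z (Z + L) := by
    have h1 := Int.floor_le ((z - Z) / L)
    have h2 := (Int.lt_floor_add_one ((z - Z) / L)).le
    rw [← hj] at h1 h2
    rw [le_div_iff₀ hL] at h1
    rw [div_le_iff₀ hL] at h2
    constructor <;> rw [hz₀] <;> linarith
  have hzj : z = z₀ + j * L := by rw [hz₀]; ring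
  have hzk : z + k * L = z₀ + (j + k : ℤ) * L := by rw [hz₀]; push_cast; ring
  have horb1 : z ∈ orb L z₀ := ⟨j, hzj⟩
  have horb2 : z + k * L ∈ orb L z₀ := ⟨_, hzk⟩
  have hosc' : ∀ y ∈ orb L z₀, ∀ y' ∈ orb L z₀,
      l 0 y - l 0 y' ≤ A * (2 + β * VV p q y + β * VV p q y') := by
    rintro y ⟨i, rfl⟩ y' ⟨i', rfl⟩
    have := hosc (z₀ + i * L) (i' - i)
    have e : z₀ + i * L + (i' - i : ℤ) * L = z₀ + i' * L := by push_cast; ring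
    rwa [e] at this
  -- centering constant
  set F : ℤ → ℝ := fun i => l 0 (z₀ + i * L) - A * (1 + β * VV p q (z₀ + i * L)) with hF
  have hbd : ∀ y ∈ orb L z₀, ∀ i, F i ≤ l 0 y + A * (1 + β * VV p q y) := by
    intro y hy i
    have := hosc' (z₀ + i * L) ⟨i, rfl⟩ y hy
    simp only [hF]
    linarith
  have hbdd : BddAbove (range F) := by
    refine ⟨l 0 z + A * (1 + β * VV p q z), ?_⟩
    rintro _ ⟨i, rfl⟩
    exact hbd z horb1 i
  set c0 := ⨆ i, F i with hc0
  have hup : ∀ y ∈ orb L z₀, c0 ≤ l 0 y + A * (1 + β * VV p q y) := fun y hy => ciSup_le (hbd y hy)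
  have hlo : ∀ y ∈ orb L z₀, l 0 y - A * (1 + β * VV p q y) ≤ c0 := by
    rintro y ⟨i, rfl⟩
    exact le_ciSup hbdd i
  have hAβ : 0 ≤ A * β := by positivity
  have n1 := super_combo_nonneg hb0 hbK hL hp hq hc hK.le hLy hl (orb L z₀) (fun _ h => orb_sub h)
    (A + c0) (A * β) (-1) hAβ (fun y hy => by have := hlo y hy; nlinarith)
  have n2 := super_combo_nonneg hb0 hbK hL hp hq hc hK.le hLy hl (orb L z₀) (fun _ h => orb_sub h)
    (A - c0) (A * β) 1 hAβ (fun y hy => by have := hup y hy; nlinarith)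
  have s1 := SS_le (p := p) (q := q) (t := T) (z := z) hc hK.le
  have s2 := SS_le (p := p) (q := q) (t := T) (z := z + k * L) hc hK.le
  have v1 := VV_pos p q (z - T)
  have v2 := VV_pos p q (z + k * L - T)
  have s1' : SS p q c K T z ≤ 1 / 2 * VV p q (z - T) + K' := by
    have := mul_le_mul_of_nonneg_right hexpT v1.le; linarith
  have s2' : SS p q c K T (z + k * L) ≤ 1 / 2 * VV p q (z + k * L - T) + K' := by
    have := mul_le_mul_of_nonneg_right hexpT v2.le; linarith
  have t1 := mul_le_mul_of_nonneg_left s1' hAβ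
  have t2 := mul_le_mul_of_nonneg_left s2' hAβ
  set V1 := VV p q (z - T)
  set V2 := VV p q (z + k * L - T)
  have hAα : A * β * K' * 2 = A * α := by linear_combination A * hβK
  by_cases hcase : 8 * K' ≤ V1 + V2
  · have m1 := n1 z horb1 T hT.le
    have m2 := n2 _ horb2 T hT.le
    have g1 : A * β * (8 * K') ≤ A * β * (V1 + V2) := by gcongr
    have g2 : 0 ≤ A * β * (V1 + V2) := by positivity
    have g3 : A * β * (V1 + V2) * α ≤ A * β * (V1 + V2) * 1 := by gcongr
    have : (1 - η) * A * (2 + β * V1 + β * V2) = 2 * A + A * β * (V1 + V2)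
      - A * α / 4 - A * β * (V1 + V2) * α / 8 := by rw [hη]; ring
    rw [this]
    linarith
  · push Not at hcase
    have r1 := hρ (z - T) (by linarith)
    have r2 := hρ (z + k * L - T) (by linarith)
    have m1 := hmin z₀ hz₀m _ _ (super_combo hc hLy hl (orb L z₀) (A + c0) (A * β) (-1) hAβ) n1 j
      (by rw [← hzj]; exact r1)
    have m2 := hmin z₀ hz₀m _ _ (super_combo hc hLy hl (orb L z₀) (A - c0) (A * β) 1 hAβ) n2 (j + k)
      (by rw [← hzk]; exact r2)
    rw [← hzk] at m2
    rw [← hzj] at m1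
    simp only [SS_zero] at m1 m2
    have g0 : 0 ≤ α * (2 * (A * β * VV p q z₀)) := by have := VV_pos p q z₀; positivity
    have g2 : 0 ≤ A * β * (V1 + V2) := by positivity
    have g3 : A * β * (V1 + V2) * α ≤ A * β * (V1 + V2) * 1 := by gcongr
    have g4 : 0 ≤ A * α := by positivity
    have : (1 - η) * A * (2 + β * V1 + β * V2) = 2 * A + A * β * (V1 + V2)
      - A * α / 4 - A * β * (V1 + V2) * α / 8 := by rw [hη]; ring
    rw [this]
    linarith

lemma osc_decay {b : ℝ → ℝ} (hb0 : ∀ z, 0 ≤ b z) (hbK : ∀ Z, ∃ K, ∀ z ≤ Z, b z ≤ K)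
    (hbinf : Tendsto b atTop atTop)
    {L : ℝ} (hL : 0 < L) {p q : ℝ} (hp : 0 < p) (hq : 0 < q) {c K : ℝ} (hc : 0 < c) (hK : 0 < K)
    (hLy : Lyap b L p q c K) :
    ∃ C > 0, ∃ a > 0, ∀ l, SolLine b L p q l → ∀ A, 0 ≤ A → (∀ z, |l 0 z| ≤ A * VV p q z) →
      ∀ t ≥ 0, ∀ z, ∀ k : ℤ, |l t z - l t (z + k * L)| ≤
        C * A * exp (-a * t) * (VV p q (z - t) + VV p q (z + k * L - t)) := by
  obtain ⟨T, hT, β, hβ, α, hα, hα1, hcon⟩ := contraction hb0 hbK hbinf hL hp hq hc hK hLy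
  set K' := K / c with hK'
  have hK'0 : 0 < K' := by positivity
  set a := -log α / T with ha
  have ha0 : 0 < a := div_pos (by have := log_neg hα hα1; linarith) hT
  have iter : ∀ l, SolLine b L p q l → ∀ A, 0 ≤ A → Osc L p q β l A → ∀ n : ℕ,
      Osc L p q β (fun t z => l (n * T + t) (z + n * T)) (α ^ n * A) := by
    intro l hl A hA ho n
    induction n with
    | zero => simpa using ho
    | succ n ih =>
      have := hcon _ (hl.shift (n * T) (by positivity)) _ (by positivity) ih
      convert this using 1
      · funext t z
        congr 1 <;> (push_cast; ring)
      · ring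
  have half : ∀ l, SolLine b L p q l → ∀ A, 0 ≤ A → (∀ z, |l 0 z| ≤ A * VV p q z) →
      ∀ t ≥ 0, ∀ z, ∀ k : ℤ, l t z - l t (z + k * L) ≤
        (K' + 1 / β) * α⁻¹ * (1 + β) * A * exp (-a * t) * (VV p q (z - t) + VV p q (z + k * L - t)) := by
    intro l hl A hA h0 t ht z k
    set n := ⌊t / T⌋₊ with hn
    have hn1 : n * T ≤ t := by
      rw [← le_div_iff₀ hT]; exact Nat.floor_le (by positivity)
    have hn2 : t ≤ (n + 1) * T := by
      rw [← div_le_iff₀ hT]; exact (Nat.lt_floor_add_one _).le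
    set s := t - n * T with hs
    have hs0 : 0 ≤ s := by linarith
    have ho : Osc L p q β (fun t z => l (s + t) (z + s)) ((K' + 1 / β) * A) := by
      intro y i
      have b1 := (abs_le.1 (lyap_bound hb0 hbK hL hp hq hc hK.le hLy hl A hA h0 (y + s) s hs0)).2
      have b2 := (abs_le.1 (lyap_bound hb0 hbK hL hp hq hc hK.le hLy hl A hA h0 (y + i * L + s) s hs0)).1
      simp only [add_zero]
      have e1 : y + s - s = y := by ring
      have e2 : y + i * L + s - s = y + i * L := by ring
      rw [e1] at b1
      rw [e2] at b2
      have v1 := VV_pos p q y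
      have v2 := VV_pos p q (y + i * L)
      have : (K' + 1 / β) * A * (2 + β * VV p q y + β * VV p q (y + i * L)) =
        2 * (A * K') + A * (VV p q y + VV p q (y + i * L)) + A * 2 / β +
          A * K' * β * (VV p q y + VV p q (y + i * L)) := by field_simp; ring
      rw [this]
      have : 0 ≤ A * 2 / β := by positivity
      have : 0 ≤ A * K' * β * (VV p q y + VV p q (y + i * L)) := by positivity
      rw [← hK'] at b1 b2
      linarith
    have h1 := iter _ (hl.shift s hs0) _ (by positivity) ho n (z - t) k
    simp only [add_zero] at h1
    have e1 : s + n * T = t := by rw [hs]; ring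
    have e2 : z - t + n * T + s = z := by rw [hs]; ring
    have e3 : z - t + k * L + n * T + s = z + k * L := by rw [hs]; ring
    have e4 : z - t + k * L = z + k * L - t := by ring
    rw [e1, e2, e3, e4] at h1
    refine h1.trans ?_
    have v1 := VV_ge_one hp hq (z - t)
    have v2 := VV_ge_one hp hq (z + k * L - t)
    have w1 : 2 + β * VV p q (z - t) + β * VV p q (z + k * L - t) ≤
      (1 + β) * (VV p q (z - t) + VV p q (z + k * L - t)) := by nlinarith
    have w2 : α ^ n ≤ α⁻¹ * exp (-a * t) := by
      rw [← rpow_natCast, ← rpow_neg_one, rpow_def_of_pos hα, rpow_def_of_pos hα, ← exp_add, exp_le_exp]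
      have : -a * t = log α * (t / T) := by rw [ha]; field_simp
      rw [this]
      have hlog := log_neg hα hα1
      have : t / T ≤ n + 1 := by rw [div_le_iff₀ hT]; exact hn2
      nlinarith
    calc α ^ n * ((K' + 1 / β) * A) * (2 + β * VV p q (z - t) + β * VV p q (z + k * L - t))
        ≤ (α⁻¹ * exp (-a * t)) * ((K' + 1 / β) * A) *
          ((1 + β) * (VV p q (z - t) + VV p q (z + k * L - t))) := by gcongr
      _ = _ := by ring
  refine ⟨(K' + 1 / β) * α⁻¹ * (1 + β), by positivity, a, ha0, ?_⟩
  intro l hl A hA h0 t ht z k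
  rw [abs_le']
  refine ⟨half l hl A hA h0 t ht z k, ?_⟩
  have := half l hl A hA h0 t ht (z + k * L) (-k)
  have e : z + k * L + (-k : ℤ) * L = z := by push_cast; ring
  rw [e] at this
  rw [neg_sub, add_comm (VV p q (z - t))]
  exact this

lemma VV_le_of_mem {p q L z : ℝ} (hp : 0 < p) (hq : 0 < q) (h1 : -L ≤ z) (h2 : z ≤ L) :
    VV p q z ≤ exp (p * L) + exp (q * L) := by
  unfold VV
  exact add_le_add (exp_le_exp.2 (by nlinarith)) (exp_le_exp.2 (by nlinarith))

lemma avg_bound {b : ℝ → ℝ} (hb0 : ∀ z, 0 ≤ b z) (hbK : ∀ Z, ∃ K, ∀ z ≤ Z, b z ≤ K)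
    (hbinf : Tendsto b atTop atTop)
    {L : ℝ} (hL : 0 < L) {p q : ℝ} (hp : 0 < p) (hq : 0 < q) {c K : ℝ} (hc : 0 < c) (hK : 0 < K)
    (hLy : Lyap b L p q c K) (dn : ℝ → ℝ) (hdn0 : ∀ w, 0 ≤ dn w) (hdni : Integrable dn)
    (hdn1 : ∫ w, dn w = 1) (hdnV : Integrable (fun w => dn w * VV p q w)) :
    ∃ C > 0, ∃ a > 0, ∀ l, SolLine b L p q l → Measurable (Function.uncurry l) →
      (∀ t < 0, ∀ z, l t z = 0) →
      ∀ A, 0 ≤ A → (∀ z, |l 0 z| ≤ A * VV p q z) →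
      (∀ t ≥ 0, ∫ w, dn w * l t (w + t) = 0) →
      ∀ t ≥ 0, ∀ w, |∫ s in t..(t + L), l s (w + s)| ≤ C * A * exp (-a * t) * VV p q w := by
  obtain ⟨C1, hC1, a, ha, hosc⟩ := osc_decay hb0 hbK hbinf hL hp hq hc hK hLy
  obtain ⟨Kb, hKb⟩ := hbK L
  have hKb0 : 0 ≤ Kb := (hb0 L).trans (hKb L le_rfl)
  set Vm := exp (p * L) + exp (q * L) with hVm
  have hVm0 : 0 < Vm := by positivity
  set C2 := Kb * (C1 * (2 * Vm)) * L with hC2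
  have hC20 : 0 ≤ C2 := by positivity
  set C3 := L * (2 * C2 + 2 * Vm * C1) with hC3
  have hC30 : 0 ≤ C3 := by positivity
  set C4 := L * C1 * (1 + Vm) + C3 with hC4
  have hC40 : 0 < C4 := by positivity
  set IV := ∫ w, dn w * VV p q w with hIV
  have hIV0 : 0 ≤ IV := integral_nonneg fun w => mul_nonneg (hdn0 w) (VV_pos _ _ _).le
  refine ⟨C4 * (1 + IV), by positivity, a, ha, ?_⟩
  intro l hl hmeas hneg A hA h0 hinv
  have hosc := hosc l hl A hA h0
  have hbound : ∀ t w, |l t (w + t)| ≤ A * (VV p q w + K / c) := by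
    intro t w
    rcases lt_or_ge t 0 with h | h
    · rw [hneg t h]
      have := VV_pos p q w
      simp only [abs_zero]; positivity
    · have := lyap_bound hb0 hbK hL hp hq hc hK.le hLy hl A hA h0 (w + t) t h
      simpa using this
  have hm2 : Measurable (fun x : ℝ × ℝ => l x.2 (x.1 + x.2)) :=
    hmeas.comp (measurable_snd.prodMk (measurable_fst.add measurable_snd))
  have hm1 : ∀ w, Measurable (fun s => l s (w + s)) := fun w =>
    hmeas.comp (measurable_id.prodMk (measurable_const.add measurable_id))
  have hItg : ∀ w s1 s2, IntervalIntegrable (fun s => l s (w + s)) volume s1 s2 := by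
    intro w s1 s2
    refine (intervalIntegrable_const (c := A * (VV p q w + K / c))).mono_fun
      (hm1 w).aestronglyMeasurable ?_
    refine Eventually.of_forall fun s => ?_
    exact (hbound s w).trans (le_abs_self _)
  have hexp : ∀ t s : ℝ, t ≤ s → exp (-a * s) ≤ exp (-a * t) := fun t s h =>
    exp_le_exp.2 (by nlinarith)
  -- step 1
  have step1 : ∀ t ≥ 0, ∀ w, ∀ k : ℤ, |(∫ s in t..(t + L), l s (w + s)) -
      ∫ s in t..(t + L), l s (w + k * L + s)| ≤
      L * (C1 * A * exp (-a * t) * (VV p q w + VV p q (w + k * L))) := by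
    intro t ht w k
    rw [← intervalIntegral.integral_sub (hItg _ _ _) (hItg _ _ _)]
    have := intervalIntegral.norm_integral_le_of_norm_le_const (a := t) (b := t + L)
      (f := fun s => l s (w + s) - l s (w + k * L + s))
      (C := C1 * A * exp (-a * t) * (VV p q w + VV p q (w + k * L))) ?_
    · rw [norm_eq_abs, add_sub_cancel_left, abs_of_pos hL] at this
      linarith
    · intro s hs
      rw [uIoc_of_le (by linarith)] at hs
      have h1 := hosc s (by linarith [hs.1]) (w + s) k
      have e1 : w + s + k * L = w + k * L + s := by ring
      rw [e1, add_sub_cancel_right, add_sub_cancel_right] at h1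
      rw [norm_eq_abs]
      refine h1.trans ?_
      have := hexp t s hs.1.le
      have := VV_pos p q w
      have := VV_pos p q (w + k * L)
      gcongr
  -- step 2
  have step2 : ∀ s ≥ 0, ∀ δ ∈ Icc 0 L, |l s (δ + s) - l (s + δ) (0 + (s + δ))| ≤
      C2 * A * exp (-a * s) := by
    intro s hs δ hδ
    have := norm_image_sub_le_of_norm_deriv_right_le_segment (f := fun t => l t (δ + s))
      (f' := fun t => b (δ + s - t) * (l t (δ + s - L) - l t (δ + s)))
      (a := s) (b := s + δ) (C := Kb * (C1 * A * exp (-a * s) * (2 * Vm))) ?_ ?_ ?_ (s + δ)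
      ⟨by linarith [hδ.1], le_rfl⟩
    · rw [norm_eq_abs, abs_sub_comm] at this
      have e1 : 0 + (s + δ) = δ + s := by ring
      rw [e1]
      refine this.trans ?_
      rw [add_sub_cancel_left]
      calc Kb * (C1 * A * exp (-a * s) * (2 * Vm)) * δ ≤
          Kb * (C1 * A * exp (-a * s) * (2 * Vm)) * L := by gcongr; exact hδ.2
        _ = _ := by rw [hC2]; ring
    · exact (hl.cont _).mono fun t ht => hs.trans ht.1
    · intro t ht
      exact hl.der _ t (hs.trans ht.1)
    · intro t ht
      rw [norm_eq_abs, abs_mul, abs_of_nonneg (hb0 _)]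
      have h1 := hosc t (hs.trans ht.1) (δ + s) (-1)
      have e1 : δ + s + ((-1 : ℤ) : ℝ) * L = δ + s - L := by push_cast; ring
      rw [e1, abs_sub_comm] at h1
      have h2 : b (δ + s - t) ≤ Kb := hKb _ (by linarith [ht.1, hδ.2])
      have h3 : VV p q (δ + s - t) ≤ Vm :=
        VV_le_of_mem hp hq (by linarith [ht.2]) (by linarith [ht.1, hδ.2])
      have h4 : VV p q (δ + s - L - t) ≤ Vm :=
        VV_le_of_mem hp hq (by linarith [ht.2]) (by linarith [ht.1, hδ.2])
      have h5 := hexp s t ht.1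
      have h6 := VV_pos p q (δ + s - t)
      have h7 := VV_pos p q (δ + s - L - t)
      calc b (δ + s - t) * |l t (δ + s - L) - l t (δ + s)| ≤
          Kb * (C1 * A * exp (-a * t) * (VV p q (δ + s - t) + VV p q (δ + s - L - t))) := by
            gcongr
        _ ≤ _ := by gcongr; linarith
  have step2' : ∀ s ≥ 0, |l (s + L) (0 + (s + L)) - l s (0 + s)| ≤
      (C2 + 2 * Vm * C1) * A * exp (-a * s) := by
    intro s hs
    have h1 := step2 s hs L ⟨hL.le, le_rfl⟩
    have h2 := hosc s hs (0 + s) 1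
    have e1 : 0 + s + ((1 : ℤ) : ℝ) * L = L + s := by push_cast; ring
    rw [e1, add_sub_cancel_right, add_sub_cancel_right] at h2
    have h3 : VV p q 0 ≤ Vm := VV_le_of_mem hp hq (by linarith) hL.le
    have h4 : VV p q L ≤ Vm := VV_le_of_mem hp hq (by linarith) le_rfl
    have h5 : C1 * A * exp (-a * s) * (VV p q 0 + VV p q L) ≤ C1 * A * exp (-a * s) * (2 * Vm) := by
      gcongr; linarith
    rw [abs_le] at *
    constructor <;> linarith [h1.1, h1.2, h2.1, h2.2]
  -- step 3
  have step3 : ∀ t ≥ 0, ∀ δ ∈ Icc 0 L, |(∫ s in t..(t + L), l s (δ + s)) -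
      ∫ s in t..(t + L), l s (0 + s)| ≤ C3 * A * exp (-a * t) := by
    intro t ht δ hδ
    have i1 : IntervalIntegrable (fun s => l (s + δ) (0 + (s + δ))) volume t (t + L) := by
      have := (hItg 0 (t + δ) (t + L + δ)).comp_add_right δ
      simpa using this
    have i2 : IntervalIntegrable (fun s => l (s + L) (0 + (s + L))) volume t (t + δ) := by
      have := (hItg 0 (t + L) (t + δ + L)).comp_add_right L
      simpa using this
    have e1 : ∫ s in t..(t + L), l (s + δ) (0 + (s + δ)) =
        ∫ s in (t + δ)..(t + L + δ), l s (0 + s) :=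
      intervalIntegral.integral_comp_add_right (fun s => l s (0 + s)) δ
    have e2 : ∫ s in t..(t + δ), l (s + L) (0 + (s + L)) =
        ∫ s in (t + L)..(t + δ + L), l s (0 + s) :=
      intervalIntegral.integral_comp_add_right (fun s => l s (0 + s)) L
    have e3 : (∫ s in t..(t + δ), l s (0 + s)) + ∫ s in (t + δ)..(t + L + δ), l s (0 + s)
        = ∫ s in t..(t + L + δ), l s (0 + s) :=
      intervalIntegral.integral_add_adjacent_intervals (hItg _ _ _) (hItg _ _ _)
    have e4 : (∫ s in t..(t + L), l s (0 + s)) + ∫ s in (t + L)..(t + L + δ), l s (0 + s)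
        = ∫ s in t..(t + L + δ), l s (0 + s) :=
      intervalIntegral.integral_add_adjacent_intervals (hItg _ _ _) (hItg _ _ _)
    have e5 : t + δ + L = t + L + δ := by ring
    rw [e5] at e2
    have e6 : (∫ s in t..(t + L), l s (δ + s)) - ∫ s in t..(t + L), l s (0 + s) =
        (∫ s in t..(t + L), (l s (δ + s) - l (s + δ) (0 + (s + δ)))) +
        ∫ s in t..(t + δ), (l (s + L) (0 + (s + L)) - l s (0 + s)) := by
      rw [intervalIntegral.integral_sub (hItg _ _ _) i1, intervalIntegral.integral_sub i2 (hItg _ _ _)]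
      linarith
    rw [e6]
    have b1 := intervalIntegral.norm_integral_le_of_norm_le_const (a := t) (b := t + L)
      (f := fun s => (l s (δ + s) - l (s + δ) (0 + (s + δ))))
      (C := C2 * A * exp (-a * t)) (by
        intro s hs
        rw [uIoc_of_le (by linarith)] at hs
        rw [norm_eq_abs]
        refine (step2 s (by linarith [hs.1]) δ hδ).trans ?_
        have := hexp t s hs.1.le
        gcongr)
    have b2 := intervalIntegral.norm_integral_le_of_norm_le_const (a := t) (b := t + δ)
      (f := fun s => (l (s + L) (0 + (s + L)) - l s (0 + s)))
      (C := (C2 + 2 * Vm * C1) * A * exp (-a * t)) (by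
        intro s hs
        rw [uIoc_of_le (by linarith [hδ.1])] at hs
        rw [norm_eq_abs]
        refine (step2' s (by linarith [hs.1])).trans ?_
        have := hexp t s hs.1.le
        gcongr)
    rw [norm_eq_abs, add_sub_cancel_left, abs_of_pos hL] at b1
    rw [norm_eq_abs, add_sub_cancel_left, abs_of_nonneg hδ.1] at b2
    have b3 : (C2 + 2 * Vm * C1) * A * exp (-a * t) * δ ≤ (C2 + 2 * Vm * C1) * A * exp (-a * t) * L := by
      gcongr; exact hδ.2
    refine (abs_add_le _ _).trans ?_
    have : C3 * A * exp (-a * t) = C2 * A * exp (-a * t) * L + (C2 + 2 * Vm * C1) * A * exp (-a * t) * L := by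
      rw [hC3]; ring
    rw [this]
    linarith
  have step4 : ∀ t ≥ 0, ∀ w, |(∫ s in t..(t + L), l s (w + s)) -
      ∫ s in t..(t + L), l s (0 + s)| ≤ C4 * A * exp (-a * t) * VV p q w := by
    intro t ht w
    set k := ⌊w / L⌋ with hk
    set δ := w - k * L with hδ
    have hδm : δ ∈ Icc 0 L := by
      have h1 := Int.floor_le (w / L)
      have h2 := (Int.lt_floor_add_one (w / L)).le
      rw [← hk] at h1 h2
      rw [le_div_iff₀ hL] at h1
      rw [div_le_iff₀ hL] at h2
      constructor <;> rw [hδ] <;> linarith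
    have h1 := step1 t ht w (-k)
    have e : w + (-k : ℤ) * L = δ := by rw [hδ]; push_cast; ring
    rw [e] at h1
    have h2 := step3 t ht δ hδm
    have v1 : VV p q δ ≤ Vm := VV_le_of_mem hp hq (by linarith [hδm.1]) hδm.2
    have v2 := VV_ge_one hp hq w
    have h3 : L * (C1 * A * exp (-a * t) * (VV p q w + VV p q δ)) ≤
        L * (C1 * A * exp (-a * t) * (VV p q w + Vm * VV p q w)) := by
      gcongr
      nlinarith
    have h4 : C3 * A * exp (-a * t) * 1 ≤ C3 * A * exp (-a * t) * VV p q w := by gcongr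
    have : C4 * A * exp (-a * t) * VV p q w =
      L * (C1 * A * exp (-a * t) * (VV p q w + Vm * VV p q w)) + C3 * A * exp (-a * t) * VV p q w := by
      rw [hC4]; ring
    rw [this]
    have := abs_sub_le (∫ s in t..(t + L), l s (w + s)) (∫ s in t..(t + L), l s (δ + s))
      (∫ s in t..(t + L), l s (0 + s))
    linarith
  -- Fubini
  intro t ht w
  have hprod : Integrable (Function.uncurry fun w s => dn w * l s (w + s))
      (volume.prod (volume.restrict (Ioc t (t + L)))) := by
    have hdom : Integrable (fun w => A * (dn w * VV p q w + K / c * dn w)) :=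
      (hdnV.add (hdni.const_mul _)).const_mul A
    have hdom2 := hdom.comp_fst (volume.restrict (Ioc t (t + L)))
    refine hdom2.mono' ?_ ?_
    · exact (hdni.aestronglyMeasurable.comp_fst).mul hm2.aestronglyMeasurable
    · refine Eventually.of_forall fun x => ?_
      simp only [Function.uncurry]
      rw [norm_eq_abs, abs_mul, abs_of_nonneg (hdn0 _)]
      have := mul_le_mul_of_nonneg_left (hbound x.2 x.1) (hdn0 x.1)
      linarith
  have hswap : ∫ w, dn w * ∫ s in t..(t + L), l s (w + s) = 0 := by
    have h1 := integral_integral_swap hprod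
    have h2 : ∫ s in Ioc t (t + L), ∫ w, dn w * l s (w + s) = 0 := by
      rw [setIntegral_congr_fun (g := fun _ => (0:ℝ)) measurableSet_Ioc]
      · simp
      · intro s hs
        exact hinv s (by linarith [hs.1])
    rw [h2] at h1
    rw [← h1]
    congr 1
    funext w
    rw [intervalIntegral.integral_of_le (by linarith), ← integral_const_mul]
  have hItg_v : Integrable (fun w => dn w * ∫ s in t..(t + L), l s (w + s)) := by
    have := hprod.integral_prod_left
    convert this using 2 with w
    rw [intervalIntegral.integral_of_le (by linarith), ← integral_const_mul]
    rfl
  have hv0 : |∫ s in t..(t + L), l s (0 + s)| ≤ C4 * A * exp (-a * t) * IV := by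
    set v0 := ∫ s in t..(t + L), l s (0 + s) with hv0
    have e1 : v0 = -∫ w, dn w * ((∫ s in t..(t + L), l s (w + s)) - v0) := by
      have : ∀ w, dn w * ((∫ s in t..(t + L), l s (w + s)) - v0) =
        dn w * (∫ s in t..(t + L), l s (w + s)) - v0 * dn w := fun w => by ring
      simp only [this]
      rw [integral_sub hItg_v (hdni.const_mul _), hswap, integral_const_mul, hdn1]
      ring
    rw [e1, abs_neg, hIV, ← integral_const_mul]
    rw [← norm_eq_abs]
    refine norm_integral_le_of_norm_le (hdnV.const_mul _) (Eventually.of_forall fun w => ?_)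
    rw [norm_eq_abs, abs_mul, abs_of_nonneg (hdn0 _)]
    have := mul_le_mul_of_nonneg_left (step4 t ht w) (hdn0 w)
    linarith
  have h1 := step4 t ht w
  have v2 := VV_ge_one hp hq w
  have h2 : C4 * A * exp (-a * t) * IV * 1 ≤ C4 * A * exp (-a * t) * IV * VV p q w := by gcongr
  have h3 := abs_sub_abs_le_abs_sub (∫ s in t..(t + L), l s (w + s)) (∫ s in t..(t + L), l s (0 + s))
  have : C4 * (1 + IV) * A * exp (-a * t) * VV p q w = C4 * A * exp (-a * t) * VV p q w +
    C4 * A * exp (-a * t) * IV * VV p q w := by ring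
  rw [this]
  linarith

/-- From exponential decay of block averages to boundedness of the primitive. -/
lemma primitive_bound {L a X Y : ℝ} (hL : 0 < L) (ha : 0 < a) (hX : 0 ≤ X)
    (u : ℝ → ℝ) (hu : ∀ s1 s2, IntervalIntegrable u volume s1 s2)
    (hY : ∀ s, |u s| ≤ Y) (hblock : ∀ t ≥ 0, |∫ s in t..(t + L), u s| ≤ X * exp (-a * t)) :
    ∀ t ≥ 0, |∫ s in (0:ℝ)..t, u s| ≤ X / (1 - exp (-a * L)) + Y * L := by
  intro t ht
  set x := exp (-a * L) with hx
  have hx0 : 0 < x := exp_pos _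
  have hx1 : x < 1 := exp_lt_one_iff.2 (by nlinarith)
  have h1x : 0 < 1 - x := by linarith
  have hsum : ∀ n : ℕ, |∫ s in (0:ℝ)..(n * L), u s| ≤ X * (1 - x ^ n) / (1 - x) := by
    intro n
    induction n with
    | zero => simp
    | succ n ih =>
      have e1 : ((n + 1 : ℕ) : ℝ) * L = n * L + L := by push_cast; ring
      rw [e1, ← intervalIntegral.integral_add_adjacent_intervals (hu 0 (n * L)) (hu _ _)]
      refine (abs_add_le _ _).trans ?_
      have h2 := hblock (n * L) (by positivity)
      have e2 : exp (-a * (n * L)) = x ^ n := by rw [hx, ← exp_nat_mul]; ring_nf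
      rw [e2] at h2
      have : X * (1 - x ^ (n + 1)) / (1 - x) = X * (1 - x ^ n) / (1 - x) + X * x ^ n := by
        field_simp; ring
      rw [this]
      linarith
  set n := ⌊t / L⌋₊ with hn
  have hn1 : n * L ≤ t := by
    rw [← le_div_iff₀ hL]; exact Nat.floor_le (by positivity)
  have hn2 : t ≤ (n + 1) * L := by
    rw [← div_le_iff₀ hL]; exact (Nat.lt_floor_add_one _).le
  rw [← intervalIntegral.integral_add_adjacent_intervals (hu 0 (n * L)) (hu _ _)]
  refine (abs_add_le _ _).trans ?_
  have h2 := intervalIntegral.norm_integral_le_of_norm_le_const (a := n * L) (b := t) (f := u) (C := Y)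
    (fun s _ => hY s)
  rw [norm_eq_abs, abs_of_nonneg (by linarith : 0 ≤ t - n * L)] at h2
  have hY0 : 0 ≤ Y := (abs_nonneg _).trans (hY 0)
  have h3 : Y * (t - n * L) ≤ Y * L := by gcongr; linarith
  have h4 : X * (1 - x ^ n) / (1 - x) ≤ X / (1 - x) := by
    have : 0 < x ^ n := by positivity
    gcongr
    nlinarith
  have := hsum n
  linarith

/-- Primitives of arbitrary functions are measurable on the half line. -/
lemma primitive_measurable (q : ℝ → ℝ) :
    ∃ G : ℝ → ℝ, Measurable G ∧ ∀ t ≥ 0, G t = ∫ s in (0:ℝ)..t, q s := by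
  classical
  set S : Set ℝ := {t | 0 ≤ t ∧ IntervalIntegrable q volume 0 t} with hS
  have hdown : ∀ t ∈ S, ∀ t', 0 ≤ t' → t' ≤ t → t' ∈ S := by
    intro t ht t' h0 h1
    refine ⟨h0, ht.2.mono_set ?_⟩
    rw [uIcc_of_le h0, uIcc_of_le ht.1]
    exact Icc_subset_Icc_right h1
  have hSm : MeasurableSet S := by
    apply OrdConnected.measurableSet
    refine ⟨fun x hx y hy z hz => hdown y hy z (hx.1.trans hz.1) hz.2⟩
  have hc : ContinuousOn (fun t => ∫ s in (0:ℝ)..t, q s) S := by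
    have key : ∀ t ∈ S, ContinuousOn (fun t => ∫ s in (0:ℝ)..t, q s) (Icc 0 t) := by
      intro t ht
      have := intervalIntegral.continuousOn_primitive_interval (μ := volume) (f := q) (a := 0) (b := t) ?_
      · rwa [uIcc_of_le ht.1] at this
      · exact ((intervalIntegrable_iff' (by simp)).1 ht.2)
    intro t ht
    by_cases h : ∃ t' ∈ S, t < t'
    · obtain ⟨t', ht', hlt⟩ := h
      refine ((key t' ht') t ⟨ht.1, hlt.le⟩).mono_of_mem_nhdsWithin ?_
      rw [mem_nhdsWithin]
      exact ⟨Iio t', isOpen_Iio, hlt, fun y hy => ⟨hy.2.1, le_of_lt hy.1⟩⟩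
    · push Not at h
      exact ((key t ht) t ⟨ht.1, le_rfl⟩).mono fun y hy => ⟨hy.1, h y hy⟩
  refine ⟨S.piecewise (fun t => ∫ s in (0:ℝ)..t, q s) (fun _ => 0),
    hc.measurable_piecewise continuousOn_const hSm, ?_⟩
  intro t ht
  by_cases h : t ∈ S
  · rw [piecewise_eq_of_mem _ _ _ h]
  · rw [piecewise_eq_of_notMem _ _ _ h, intervalIntegral.integral_undef]
    exact fun h' => h ⟨ht, h'⟩

/-- Cumulated rate along a line. -/
def HH (b : ℝ → ℝ) (t z : ℝ) : ℝ := ∫ s in (0:ℝ)..t, b (z - s)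

lemma HH_cont {b : ℝ → ℝ} (hb : Continuous b) : Continuous (fun x : ℝ × ℝ => HH b x.1 x.2) := by
  unfold HH
  exact intervalIntegral.continuous_parametric_intervalIntegral_of_continuous
    (f := fun (x : ℝ × ℝ) s => b (x.2 - s)) (by fun_prop) continuous_fst

lemma HH_cont1 {b : ℝ → ℝ} (hb : Continuous b) (z : ℝ) : Continuous (fun t => HH b t z) :=
  (HH_cont hb).comp (continuous_id.prodMk continuous_const)

lemma HH_deriv {b : ℝ → ℝ} (hb : Continuous b) (z t : ℝ) :
    HasDerivAt (fun t => HH b t z) (b (z - t)) t := by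
  unfold HH
  have hc : Continuous fun s => b (z - s) := by fun_prop
  exact intervalIntegral.integral_hasDerivAt_right (hc.intervalIntegrable _ _)
    (hc.stronglyMeasurableAtFilter _ _) hc.continuousAt

structure LineMild (b g : ℝ → ℝ) (L p q : ℝ) (m : ℝ → ℝ → ℝ) : Prop where
  eq : ∀ t ≥ 0, ∀ z, m t z = exp (-HH b t z) * (g z + ∫ s in (0:ℝ)..t,
    b (z - s) * exp (HH b s z) * m s (z - L))
  bdd : ∀ r > 0, ∃ C, ∀ t, 0 ≤ t → t ≤ r → ∀ z, |m t z| ≤ C * VV p q (z - t)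

lemma LineMild.meas1 {b g : ℝ → ℝ} {L p q : ℝ} {m : ℝ → ℝ → ℝ} (hb : Continuous b)
    (h : LineMild b g L p q m) (z : ℝ) :
    ∃ G : ℝ → ℝ, Measurable G ∧ ∀ t ≥ 0, G t = m t z := by
  obtain ⟨G, hG, hGe⟩ := primitive_measurable (fun s => b (z - s) * exp (HH b s z) * m s (z - L))
  have hH := (HH_cont1 hb z).measurable
  refine ⟨fun t => exp (-HH b t z) * (g z + G t), by fun_prop, ?_⟩
  intro t ht
  simp only [h.eq t ht, hGe t ht]

lemma LineMild.int {b g : ℝ → ℝ} {L p q : ℝ} {m : ℝ → ℝ → ℝ} (hb : Continuous b)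
    (h : LineMild b g L p q m) (z t : ℝ) (ht : 0 ≤ t) :
    IntervalIntegrable (fun s => b (z - s) * exp (HH b s z) * m s (z - L)) volume 0 t := by
  obtain ⟨G, hG, hGe⟩ := h.meas1 hb (z - L)
  obtain ⟨C, hC⟩ := h.bdd (t + 1) (by linarith)
  have hH := HH_cont1 hb z
  have hVc := VV_cont p q
  have i1 : Continuous (fun s => |b (z - s) * exp (HH b s z)| * (C * VV p q (z - L - s))) := by
    fun_prop
  rw [intervalIntegrable_iff_integrableOn_Ioc_of_le ht]
  have i2 := (intervalIntegrable_iff_integrableOn_Ioc_of_le ht).1 (i1.intervalIntegrable (μ := volume) 0 t)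
  refine Integrable.mono' i2 ?_ ?_
  · refine AEStronglyMeasurable.congr
      (f := fun s => b (z - s) * exp (HH b s z) * G s) ?_ ?_
    · have := hH.measurable
      have := hb.measurable
      apply Measurable.aestronglyMeasurable
      fun_prop
    · filter_upwards [ae_restrict_mem measurableSet_Ioc] with s hs
      rw [hGe s hs.1.le]
  · filter_upwards [ae_restrict_mem measurableSet_Ioc] with s hs
    rw [norm_eq_abs, abs_mul]
    gcongr
    exact hC s hs.1.le (by linarith [hs.2]) _

lemma LineMild.cont {b g : ℝ → ℝ} {L p q : ℝ} {m : ℝ → ℝ → ℝ} (hb : Continuous b)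
    (h : LineMild b g L p q m) (z : ℝ) : ContinuousOn (fun t => m t z) (Ici 0) := by
  have hH := HH_cont1 hb z
  have hP : ContinuousOn (fun t => ∫ s in (0:ℝ)..t,
    b (z - s) * exp (HH b s z) * m s (z - L)) (Ici 0) := by
    intro t ht
    have ht0 : 0 ≤ t := ht
    have := intervalIntegral.continuousOn_primitive_interval (μ := volume)
      (f := fun s => b (z - s) * exp (HH b s z) * m s (z - L)) (a := 0) (b := t + 1)
      ((intervalIntegrable_iff' enorm_ne_top).1 (h.int hb z (t + 1) (by linarith)))
    rw [uIcc_of_le (by linarith)] at this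
    refine (this t ⟨ht0, by linarith⟩).mono_of_mem_nhdsWithin ?_
    rw [mem_nhdsWithin]
    exact ⟨Iio (t + 1), isOpen_Iio, by simp, fun y hy => ⟨hy.2, le_of_lt hy.1⟩⟩
  have : ContinuousOn (fun t => exp (-HH b t z) * (g z + ∫ s in (0:ℝ)..t,
    b (z - s) * exp (HH b s z) * m s (z - L))) (Ici 0) := by
    refine ContinuousOn.mul ?_ (continuousOn_const.add hP)
    exact (by fun_prop : Continuous fun t => exp (-HH b t z)).continuousOn
  exact this.congr fun t ht => h.eq t ht z

lemma LineMild.solLine {b g : ℝ → ℝ} {L p q : ℝ} {m : ℝ → ℝ → ℝ} (hb : Continuous b)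
    (h : LineMild b g L p q m) : SolLine b L p q m := by
  refine ⟨h.cont hb, ?_, h.bdd⟩
  intro z t ht
  have hH := HH_cont1 hb z
  have hmc : Continuous (fun s => m (max s 0) (z - L)) := by
    have := h.cont hb (z - L)
    rw [← continuousOn_univ]
    exact this.comp (f := fun s : ℝ => max s 0) (by fun_prop) (fun s _ => mem_Ici.2 (le_max_right s 0))
  have hqc : Continuous (fun s => b (z - s) * exp (HH b s z) * m (max s 0) (z - L)) :=
    ((hb.comp (continuous_const.sub continuous_id)).mul (continuous_exp.comp hH)).mul hmc
  have e : ∀ t ≥ 0, m t z = exp (-HH b t z) * (g z + ∫ s in (0:ℝ)..t,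
      b (z - s) * exp (HH b s z) * m (max s 0) (z - L)) := by
    intro t ht
    rw [h.eq t ht]
    congr 2
    apply intervalIntegral.integral_congr
    intro s hs
    rw [uIcc_of_le ht] at hs
    simp only [max_eq_left hs.1]
  have d1 : HasDerivAt (fun t => ∫ s in (0:ℝ)..t,
      b (z - s) * exp (HH b s z) * m (max s 0) (z - L))
      (b (z - t) * exp (HH b t z) * m (max t 0) (z - L)) t :=
    intervalIntegral.integral_hasDerivAt_right (hqc.intervalIntegrable _ _)
      (hqc.stronglyMeasurableAtFilter _ _) hqc.continuousAt
  have d2 := ((HH_deriv hb z t).fun_neg.exp).fun_mul (d1.const_add (g z))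
  have d3 := (d2.hasDerivWithinAt (s := Ici t)).congr (f₁ := fun t => m t z)
    (fun s hs => e s (ht.trans hs)) (e t ht)
  refine d3.congr_deriv ?_
  rw [e t ht, max_eq_left ht]
  have : exp (-HH b t z) * exp (HH b t z) = 1 := by rw [← exp_add]; simp
  linear_combination (b (z - t) * m t (z - L)) * this

/-- Picard iterates. -/
def Lam (b g : ℝ → ℝ) (L : ℝ) : ℕ → ℝ → ℝ → ℝ
  | 0 => fun _ _ => 0
  | n + 1 => fun t z => exp (-HH b t z) * (g z + ∫ s, if 0 < s ∧ s ≤ t then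
      b (z - s) * exp (HH b s z) * Lam b g L n s (z - L) else 0)

lemma Lam_meas {b g : ℝ → ℝ} (hb : Continuous b) (hg : Measurable g) (L : ℝ) (n : ℕ) :
    Measurable (fun x : ℝ × ℝ => Lam b g L n x.1 x.2) := by
  induction n with
  | zero => simp only [Lam]; fun_prop
  | succ n ih =>
    simp only [Lam]
    have hH := (HH_cont hb).measurable
    have hbm := hb.measurable
    have h1 : Measurable (fun y : (ℝ × ℝ) × ℝ => if 0 < y.2 ∧ y.2 ≤ y.1.1 then
      b (y.1.2 - y.2) * exp (HH b y.2 y.1.2) * Lam b g L n y.2 (y.1.2 - L) else 0) := by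
      refine Measurable.ite ?_ ?_ measurable_const
      · exact (measurableSet_lt measurable_const measurable_snd).inter
          (measurableSet_le measurable_snd (measurable_fst.comp measurable_fst))
      · refine Measurable.mul (Measurable.mul (by fun_prop) ?_) ?_
        · exact measurable_exp.comp (hH.comp (measurable_snd.prodMk (measurable_snd.comp measurable_fst)))
        · exact ih.comp (measurable_snd.prodMk ((measurable_snd.comp measurable_fst).sub_const _))
    have h2 := (h1.stronglyMeasurable.integral_prod_right' (ν := volume)).measurable
    exact (measurable_exp.comp hH.neg).mul ((hg.comp measurable_snd).add h2)

lemma Lam_succ {b g : ℝ → ℝ} (L : ℝ) (n : ℕ) (t z : ℝ) (ht : 0 ≤ t) :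
    Lam b g L (n + 1) t z = exp (-HH b t z) * (g z + ∫ s in (0:ℝ)..t,
      b (z - s) * exp (HH b s z) * Lam b g L n s (z - L)) := by
  simp only [Lam]
  congr 2
  rw [intervalIntegral.integral_of_le ht, ← integral_indicator measurableSet_Ioc]
  congr 1
  funext s
  by_cases h : 0 < s ∧ s ≤ t
  · rw [if_pos h, indicator_of_mem (mem_Ioc.2 h)]
  · rw [if_neg h, indicator_of_notMem (fun h' => h (mem_Ioc.1 h'))]

lemma Lam_err {b g : ℝ → ℝ} (hb : Continuous b) (hb0 : ∀ z, 0 ≤ b z) (hg : Measurable g)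
    {L p q : ℝ} (hL : 0 < L) {m : ℝ → ℝ → ℝ} (h : LineMild b g L p q m) {K Z T C κ : ℝ}
    (hK : ∀ z ≤ Z, b z ≤ K) (hC : 0 ≤ C)
    (hmC : ∀ t, 0 ≤ t → t ≤ T → ∀ z ≤ Z, |m t z| ≤ C * exp (-p * z)) (hκ : 0 < κ)
    (hκ1 : 2 * K * exp (p * L) ≤ κ) (n : ℕ) :
    ∀ t, 0 ≤ t → t ≤ T → ∀ z ≤ Z,
      |m t z - Lam b g L n t z| ≤ C * exp (-p * z) * exp (κ * t) * (1 / 2) ^ n := by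
  have hK0 : 0 ≤ K := (hb0 Z).trans (hK Z le_rfl)
  induction n with
  | zero =>
    intro t ht htT z hz
    simp only [Lam, sub_zero, pow_zero, mul_one]
    refine (hmC t ht htT z hz).trans ?_
    have : 1 ≤ exp (κ * t) := one_le_exp (by positivity)
    have h2 : 0 ≤ C * exp (-p * z) := by positivity
    nlinarith
  | succ n ih =>
    intro t ht htT z hz
    have hH := HH_cont1 hb z
    have hzL : z - L ≤ Z := by linarith
    have hi1 := h.int hb z t ht
    have hgood : ∀ s ∈ Ioc 0 t, ‖b (z - s) * exp (HH b s z) * m s (z - L) -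
        b (z - s) * exp (HH b s z) * Lam b g L n s (z - L)‖ ≤
        exp (HH b t z) * (C * exp (-p * z) * (1 / 2) ^ (n + 1)) * (κ * exp (κ * s)) := by
      intro s hs
      have h1 := ih s hs.1.le (hs.2.trans htT) (z - L) hzL
      have h2 : b (z - s) ≤ K := hK _ (by linarith [hs.1])
      have h3 : HH b s z ≤ HH b t z := by
        have e1 : HH b t z - HH b s z = ∫ r in s..t, b (z - r) := by
          unfold HH
          have hc : Continuous fun s => b (z - s) := by fun_prop
          exact intervalIntegral.integral_interval_sub_left (hc.intervalIntegrable _ _)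
            (hc.intervalIntegrable _ _)
        have := intervalIntegral.integral_nonneg (μ := volume) (f := fun r => b (z - r)) hs.2 (fun r _ => hb0 _)
        linarith
      rw [← mul_sub, norm_eq_abs, abs_mul, abs_mul, abs_of_nonneg (hb0 _), abs_of_pos (exp_pos _)]
      have e2 : exp (-p * (z - L)) = exp (p * L) * exp (-p * z) := by rw [← exp_add]; ring_nf
      rw [e2] at h1
      calc b (z - s) * exp (HH b s z) * |m s (z - L) - Lam b g L n s (z - L)|
          ≤ K * exp (HH b t z) * (C * (exp (p * L) * exp (-p * z)) * exp (κ * s) * (1 / 2) ^ n) := by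
            have := hb0 (z - s)
            gcongr
        _ = (2 * K * exp (p * L)) * (exp (HH b t z) * (C * exp (-p * z) * (1 / 2) ^ (n + 1)) *
              exp (κ * s)) := by ring
        _ ≤ κ * (exp (HH b t z) * (C * exp (-p * z) * (1 / 2) ^ (n + 1)) * exp (κ * s)) := by
            gcongr
        _ = _ := by ring
    have hgc : Continuous (fun s => exp (HH b t z) * (C * exp (-p * z) * (1 / 2) ^ (n + 1)) *
        (κ * exp (κ * s))) := by fun_prop
    have hLm : Measurable (fun s => b (z - s) * exp (HH b s z) * Lam b g L n s (z - L)) := by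
      have h1 := hH.measurable
      have h2 := hb.measurable
      have h3 : Measurable (fun s => Lam b g L n s (z - L)) :=
        (Lam_meas hb hg L n).comp (measurable_id.prodMk measurable_const)
      fun_prop
    have hid : IntervalIntegrable (fun s => b (z - s) * exp (HH b s z) * m s (z - L) -
        b (z - s) * exp (HH b s z) * Lam b g L n s (z - L)) volume 0 t := by
      have i3 := hgc.intervalIntegrable (μ := volume) 0 t
      rw [intervalIntegrable_iff_integrableOn_Ioc_of_le ht] at i3 hi1 ⊢
      refine Integrable.mono' i3 (hi1.aestronglyMeasurable.sub hLm.aestronglyMeasurable) ?_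
      filter_upwards [ae_restrict_mem measurableSet_Ioc] with s hs
      exact hgood s hs
    have hi2 : IntervalIntegrable (fun s => b (z - s) * exp (HH b s z) * Lam b g L n s (z - L))
        volume 0 t := by
      have := hi1.sub hid
      simpa using this
    rw [Lam_succ L n t z ht, h.eq t ht z, ← mul_sub, add_sub_add_left_eq_sub,
      ← intervalIntegral.integral_sub hi1 hi2, abs_mul, abs_of_pos (exp_pos _)]
    have hb1 := intervalIntegral.norm_integral_le_of_norm_le ht
      (Eventually.of_forall hgood) (hgc.intervalIntegrable (μ := volume) 0 t)
    have hItg : ∫ s in (0:ℝ)..t, κ * exp (κ * s) = exp (κ * t) - 1 := by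
      have := intervalIntegral.integral_eq_sub_of_hasDerivAt (a := 0) (b := t) (f := fun s => exp (κ * s))
        (f' := fun s => κ * exp (κ * s)) (fun s _ => by
          have := ((hasDerivAt_id s).const_mul κ).exp
          refine this.congr_deriv ?_
          simp; ring) (by
          apply Continuous.intervalIntegrable; fun_prop)
      simpa using this
    rw [intervalIntegral.integral_const_mul, hItg, norm_eq_abs] at hb1
    have e3 : exp (-HH b t z) * exp (HH b t z) = 1 := by rw [← exp_add]; simp
    calc _ ≤ exp (-HH b t z) * (exp (HH b t z) * (C * exp (-p * z) * (1 / 2) ^ (n + 1)) *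
          (exp (κ * t) - 1)) := by gcongr
      _ = (exp (-HH b t z) * exp (HH b t z)) * ((C * exp (-p * z) * (1 / 2) ^ (n + 1)) *
          (exp (κ * t) - 1)) := by ring
      _ ≤ _ := by
        rw [e3, one_mul]
        have : 0 ≤ C * exp (-p * z) * (1 / 2) ^ (n + 1) := by positivity
        nlinarith

lemma LineMild.meas {b g : ℝ → ℝ} (hb : Continuous b) (hb0 : ∀ z, 0 ≤ b z)
    (hbK : ∀ Z, ∃ K, ∀ z ≤ Z, b z ≤ K) (hg : Measurable g)
    {L p q : ℝ} (hL : 0 < L) (hp : 0 < p) (hq : 0 < q)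
    {m : ℝ → ℝ → ℝ} (h : LineMild b g L p q m) :
    Measurable (fun x : ℝ × ℝ => if 0 ≤ x.1 then m x.1 x.2 else 0) := by
  refine measurable_of_tendsto_metrizable
    (f := fun n (x : ℝ × ℝ) => if 0 ≤ x.1 then Lam b g L n x.1 x.2 else 0) ?_ ?_
  · intro n
    exact Measurable.ite (measurableSet_le measurable_const measurable_fst) (Lam_meas hb hg L n)
      measurable_const
  · rw [tendsto_pi_nhds]
    rintro ⟨t, z⟩
    by_cases ht : 0 ≤ t
    · simp only [ht, if_true]
      obtain ⟨K, hK⟩ := hbK z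
      have hK0 : 0 ≤ K := (hb0 z).trans (hK z le_rfl)
      obtain ⟨C, hC⟩ := h.bdd (t + 1) (by linarith)
      have hC0 : 0 ≤ C := by
        have h1 := (abs_nonneg _).trans (hC 0 le_rfl (by linarith) 0)
        exact nonneg_of_mul_nonneg_left h1 (VV_pos _ _ _)
      have hmC : ∀ s, 0 ≤ s → s ≤ t → ∀ y ≤ z, |m s y| ≤
          C * (exp (p * t) + exp ((p + q) * z)) * exp (-p * y) := by
        intro s hs0 hst y hy
        refine (hC s hs0 (by linarith) y).trans ?_
        rw [mul_assoc]
        gcongr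
        unfold VV
        rw [add_mul, ← exp_add, ← exp_add]
        exact add_le_add (exp_le_exp.2 (by nlinarith)) (exp_le_exp.2 (by nlinarith))
      have herr := fun n => Lam_err hb hb0 hg hL h hK
        (by positivity) hmC (κ := 2 * K * exp (p * L) + 1) (by positivity) (by linarith) n t ht le_rfl z le_rfl
      rw [tendsto_iff_dist_tendsto_zero]
      refine squeeze_zero (fun n => dist_nonneg) (fun n => ?_) (g := fun n : ℕ =>
        C * (exp (p * t) + exp ((p + q) * z)) * exp (-p * z) * exp ((2 * K * exp (p * L) + 1) * t) *
          (1 / 2) ^ n) ?_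
      · rw [dist_comm, Real.dist_eq]; exact herr n
      · have := (tendsto_pow_atTop_nhds_zero_of_lt_one (r := (1/2:ℝ)) (by norm_num) (by norm_num)).const_mul
          (C * (exp (p * t) + exp ((p + q) * z)) * exp (-p * z) * exp ((2 * K * exp (p * L) + 1) * t))
        simpa using this
    · simp only [ht, if_false]
      exact tendsto_const_nhds

lemma integrable_exp_neg_abs' : Integrable (fun z : ℝ => exp (-|z|)) := by
  rw [← integrableOn_univ, ← Iic_union_Ioi (a := (0:ℝ))]
  refine IntegrableOn.union ?_ ?_
  · refine (integrableOn_exp_Iic 0).congr_fun (fun z hz => ?_) measurableSet_Iic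
    simp only [abs_of_nonpos (mem_Iic.1 hz), neg_neg]
  · refine (integrableOn_exp_neg_Ioi 0).congr_fun (fun z hz => ?_) measurableSet_Ioi
    simp only [abs_of_pos (mem_Ioi.1 hz)]

lemma exp_neg_abs_shift {z t T : ℝ} (h0 : 0 ≤ t) (h1 : t ≤ T) :
    exp (-|z - t|) ≤ exp T * exp (-|z|) := by
  rw [← exp_add]
  refine exp_le_exp.2 ?_
  have := abs_sub_abs_le_abs_sub z (z - t)
  have e : z - (z - t) = t := by ring
  rw [e, abs_of_nonneg h0] at this
  linarith

lemma invariance {b dn : ℝ → ℝ} {L p q : ℝ} {l : ℝ → ℝ → ℝ} (hb : Continuous b)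
    (hb0 : ∀ z, 0 ≤ b z)
    (hdn : ∀ z, HasDerivAt dn (b (z + L) * dn (z + L) - b z * dn z) z)
    (hQ : ∃ C, ∀ y, b y * |dn y| * VV p q (y - L) ≤ C * exp (-|y|))
    (hD : ∃ C, ∀ y, |dn y| * VV p q y ≤ C * exp (-|y|))
    (hl : SolLine b L p q l) (hm : Measurable (Function.uncurry l)) (T : ℝ) (hT : 0 ≤ T) :
    ∫ w, dn w * l T (w + T) = ∫ w, dn w * l 0 w := by
  have hdc : Continuous dn := continuous_iff_continuousAt.2 fun z => (hdn z).continuousAt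
  obtain ⟨CQ, hCQ⟩ := hQ
  obtain ⟨CD, hCD⟩ := hD
  obtain ⟨C, hC⟩ := hl.bdd (T + 1) (by linarith)
  have hC0 : 0 ≤ C := by
    have h1 := (abs_nonneg _).trans (hC 0 le_rfl (by linarith) 0)
    exact nonneg_of_mul_nonneg_left h1 (VV_pos _ _ _)
  have hCQ0 : 0 ≤ CQ := by
    have h1 := hCQ 0
    have h2 : 0 ≤ b 0 * |dn 0| * VV p q (0 - L) :=
      mul_nonneg (mul_nonneg (hb0 _) (abs_nonneg _)) (VV_pos _ _ _).le
    exact nonneg_of_mul_nonneg_left (h2.trans h1) (exp_pos _)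
  have hCD0 : 0 ≤ CD := by
    have h1 := hCD 0
    have h2 : 0 ≤ |dn 0| * VV p q 0 :=
      mul_nonneg (abs_nonneg _) (VV_pos _ _ _).le
    exact nonneg_of_mul_nonneg_left (h2.trans h1) (exp_pos _)
  set F : ℝ → ℝ → ℝ := fun t z => b (z - t) * dn (z - t) * l t (z - L) with hF
  have hFm : Measurable (Function.uncurry F) := by
    have h1 : Measurable (fun x : ℝ × ℝ => l x.1 (x.2 - L)) :=
      hm.comp (measurable_fst.prodMk (measurable_snd.sub_const _))
    have h2 := hb.measurable
    have h3 := hdc.measurable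
    exact ((h2.comp (measurable_snd.sub measurable_fst)).mul
      (h3.comp (measurable_snd.sub measurable_fst))).mul h1
  have hFb : ∀ t, 0 ≤ t → t ≤ T → ∀ z, |F t z| ≤ C * CQ * exp T * exp (-|z|) := by
    intro t h0 h1 z
    simp only [hF]
    rw [abs_mul, abs_mul, abs_of_nonneg (hb0 _)]
    have h2 := hC t h0 (by linarith) (z - L)
    have e : z - L - t = z - t - L := by ring
    rw [e] at h2
    have h3 := hb0 (z - t)
    calc b (z - t) * |dn (z - t)| * |l t (z - L)| ≤
        b (z - t) * |dn (z - t)| * (C * VV p q (z - t - L)) := by gcongr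
      _ = C * (b (z - t) * |dn (z - t)| * VV p q (z - t - L)) := by ring
      _ ≤ C * (CQ * exp (-|z - t|)) := mul_le_mul_of_nonneg_left (hCQ _) hC0
      _ ≤ C * (CQ * (exp T * exp (-|z|))) := by gcongr; exact exp_neg_abs_shift h0 h1
      _ = _ := by ring
  have hGi : ∀ t, 0 ≤ t → t ≤ T → Integrable (fun z => dn (z - t) * l t z) := by
    intro t h0 h1
    refine (integrable_exp_neg_abs'.const_mul (C * CD * exp T)).mono' ?_ ?_
    · apply Measurable.aestronglyMeasurable
      exact (hdc.measurable.comp (measurable_id.sub_const _)).mul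
        (hm.comp (measurable_const.prodMk measurable_id))
    · refine Eventually.of_forall fun z => ?_
      rw [norm_eq_abs, abs_mul]
      have h2 := hC t h0 (by linarith) z
      calc |dn (z - t)| * |l t z| ≤ |dn (z - t)| * (C * VV p q (z - t)) := by gcongr
        _ = C * (|dn (z - t)| * VV p q (z - t)) := by ring
        _ ≤ C * (CD * exp (-|z - t|)) := mul_le_mul_of_nonneg_left (hCD _) hC0
        _ ≤ C * (CD * (exp T * exp (-|z|))) := by gcongr; exact exp_neg_abs_shift h0 h1
        _ = _ := by ring
  have hFi : ∀ t, 0 ≤ t → t ≤ T → Integrable (F t) := by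
    intro t h0 h1
    refine (integrable_exp_neg_abs'.const_mul (C * CQ * exp T)).mono' ?_ ?_
    · exact (hFm.comp (measurable_const.prodMk measurable_id)).aestronglyMeasurable
    · exact Eventually.of_forall fun z => hFb t h0 h1 z
  have hFc : ∀ z, ContinuousOn (fun t => F t z) (Ici 0) := by
    intro z
    simp only [hF]
    refine ContinuousOn.mul (Continuous.continuousOn (by fun_prop)) (hl.cont _)
  have hftc : ∀ z, dn (z - T) * l T z - dn z * l 0 z = ∫ t in (0:ℝ)..T, (F t z - F t (z + L)) := by
    intro z
    rw [intervalIntegral.integral_eq_sub_of_hasDeriv_right_of_le hT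
      (f := fun t => dn (z - t) * l t z)]
    · simp
    · exact ContinuousOn.mul (Continuous.continuousOn (by fun_prop))
        ((hl.cont z).mono fun t ht => ht.1)
    · intro t ht
      have d1 : HasDerivAt (fun t => dn (z - t))
          (-(b (z - t + L) * dn (z - t + L) - b (z - t) * dn (z - t))) t := by
        have := (hdn (z - t)).comp t ((hasDerivAt_id t).const_sub z)
        refine this.congr_deriv ?_
        ring
      have d2 := (hl.der z t ht.1.le).mono (Ioi_subset_Ici_self)
      have d3 := (d1.hasDerivWithinAt (s := Ioi t)).fun_mul d2
      refine d3.congr_deriv ?_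
      simp only [hF]
      have e1 : z + L - t = z - t + L := by ring
      have e2 : z + L - L = z := by ring
      rw [e1, e2]
      ring
    · refine ContinuousOn.intervalIntegrable ?_
      rw [uIcc_of_le hT]
      exact ((hFc z).sub (hFc (z + L))).mono fun t ht => ht.1
  have hprod : Integrable (Function.uncurry fun z t => F t z - F t (z + L))
      (volume.prod (volume.restrict (Ioc 0 T))) := by
    have hdom : Integrable (fun z => C * CQ * exp T * (exp (-|z|) + exp (-|z + L|))) :=
      (integrable_exp_neg_abs'.add (integrable_exp_neg_abs'.comp_add_right L)).const_mul _
    have hdom2 := hdom.comp_fst (volume.restrict (Ioc 0 T))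
    refine hdom2.mono' ?_ ?_
    · apply Measurable.aestronglyMeasurable
      exact (hFm.comp (measurable_snd.prodMk measurable_fst)).sub
        (hFm.comp (measurable_snd.prodMk (measurable_fst.add_const _)))
    · have hmem : ∀ᵐ x ∂((volume : Measure ℝ).prod (volume.restrict (Ioc 0 T))), x.2 ∈ Ioc 0 T :=
        Measure.quasiMeasurePreserving_snd.ae (ae_restrict_mem measurableSet_Ioc)
      filter_upwards [hmem] with x hx
      simp only [Function.uncurry]
      rw [norm_eq_abs]
      have h1 := hFb x.2 hx.1.le hx.2 x.1
      have h2 := hFb x.2 hx.1.le hx.2 (x.1 + L)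
      refine (abs_sub _ _).trans ?_
      linarith
  have hswap := integral_integral_swap hprod
  have hz : ∫ t in Ioc 0 T, ∫ z, (F t z - F t (z + L)) = 0 := by
    rw [setIntegral_congr_fun (g := fun _ => (0:ℝ)) measurableSet_Ioc]
    · simp
    · intro t ht
      have i1 := hFi t ht.1.le ht.2
      simp only
      rw [integral_sub i1 (i1.comp_add_right L), integral_add_right_eq_self (F t) L, sub_self]
  rw [hz] at hswap
  have h1 : ∫ z, (dn (z - T) * l T z - dn z * l 0 z) = 0 := by
    refine Eq.trans ?_ hswap
    congr 1
    funext z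
    rw [hftc z, intervalIntegral.integral_of_le hT]
  have hG0 := hGi 0 le_rfl hT
  simp only [sub_zero] at hG0
  rw [integral_sub (hGi T hT le_rfl) hG0] at h1
  rw [← integral_add_right_eq_self (fun z => dn (z - T) * l T z) T] at h1
  simp only [add_sub_cancel_right] at h1
  linarith

lemma integral_exp_line (g : ℝ → ℝ) : ∫ x, exp x * g (exp x) = ∫ y in Ioi (0:ℝ), g y := by
  symm
  rw [← Real.range_exp, ← image_univ]
  simpa [abs_of_pos (exp_pos _)] using integral_image_eq_integral_abs_deriv_smul
      MeasurableSet.univ (fun x _ ↦ (hasDerivAt_exp x).hasDerivWithinAt)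
      (fun x _ y _ hxy ↦ exp_injective hxy) g

lemma wVV (r₁ r₂ y : ℝ) : exp y ^ r₁ + exp y ^ r₂ = exp y * VV (1 - r₁) (r₂ - 1) y := by
  unfold VV
  rw [mul_add, ← exp_add, ← exp_add, ← exp_mul, ← exp_mul]
  congr 2 <;> ring

section rate
variable {B : ℝ → ℝ}

lemma b_cont (hB : Bhyp B) : Continuous (fun z => B (exp z)) :=
  hB.1.comp_continuous continuous_exp (fun z => exp_pos z)

lemma b_nonneg (hB : Bhyp B) (z : ℝ) : 0 ≤ B (exp z) := hB.2.1 _ (exp_pos z)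

lemma b_bot (hB : Bhyp B) (hB2 : HypA2 B) : Tendsto (fun z => B (exp z)) atBot (𝓝 0) := by
  obtain ⟨b₀, hb₀, γ₀, hγ₀, K₀, hK₀, h⟩ := hB2.2.2.1
  refine squeeze_zero' (g := fun z => K₀ * exp (z * γ₀))
    (Eventually.of_forall fun z => b_nonneg hB z) ?_ ?_
  · filter_upwards [eventually_lt_atBot (Real.log b₀)] with z hz
    have h1 : exp z < b₀ := by rwa [← lt_log_iff_exp_lt hb₀]
    rw [exp_mul]
    exact h _ (exp_pos z) h1
  · have : Tendsto (fun z : ℝ => z * γ₀) atBot atBot := tendsto_id.atBot_mul_const hγ₀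
    simpa using (tendsto_exp_atBot.comp this).const_mul K₀

lemma b_top (hB2 : HypA2 B) : Tendsto (fun z => B (exp z)) atTop atTop := by
  obtain ⟨b₁, hb₁, γ₁, hγ₁, γ₂, hγ₂, K₁, hK₁, K₂, hK₂, h⟩ := hB2.2.2.2
  refine tendsto_atTop_mono' (f₁ := fun z => K₁ * exp (z * γ₁)) atTop ?_ ?_
  · filter_upwards [eventually_gt_atTop (Real.log b₁)] with z hz
    have h1 : b₁ < exp z := by rwa [← log_lt_iff_lt_exp hb₁]
    rw [exp_mul]
    exact (h _ h1).1
  · have : Tendsto (fun z : ℝ => z * γ₁) atTop atTop := tendsto_id.atTop_mul_const hγ₁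
    exact (tendsto_exp_atTop.comp this).const_mul_atTop hK₁

lemma b_bdd (hB : Bhyp B) (hB2 : HypA2 B) : ∀ Z, ∃ K, ∀ z ≤ Z, B (exp z) ≤ K := by
  intro Z
  obtain ⟨z0, hz0⟩ := eventually_atBot.1 ((b_bot hB hB2).eventually_lt_const (u := 1) one_pos)
  obtain ⟨K, hK⟩ := (isCompact_Icc (a := z0) (b := Z)).bddAbove_image (b_cont hB).continuousOn
  refine ⟨max 1 K, fun z hz => ?_⟩
  rcases le_total z z0 with h | h
  · exact (hz0 z h).le.trans (le_max_left _ _)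
  · exact (hK (mem_image_of_mem _ ⟨h, hz⟩)).trans (le_max_right _ _)

lemma b_growth (hB : Bhyp B) (hB2 : HypA2 B) :
    ∃ K ≥ 0, ∃ γ, ∀ z, B (exp z) ≤ K * (1 + exp (γ * z)) := by
  obtain ⟨b₁, hb₁, γ₁, hγ₁, γ₂, hγ₂, K₁, hK₁, K₂, hK₂, h⟩ := hB2.2.2.2
  obtain ⟨K, hK⟩ := b_bdd hB hB2 (Real.log b₁)
  have hK0 : 0 ≤ K := (b_nonneg hB _).trans (hK _ le_rfl)
  refine ⟨K + K₂, by positivity, γ₂, fun z => ?_⟩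
  have he : 0 < exp (γ₂ * z) := exp_pos _
  rcases le_or_gt z (Real.log b₁) with h1 | h1
  · have := hK z h1
    nlinarith [mul_pos hK₂ he, mul_nonneg hK0 he.le]
  · have h2 : b₁ < exp z := by rwa [← log_lt_iff_lt_exp hb₁]
    have h3 := (h _ h2).2
    rw [← exp_mul, mul_comm z] at h3
    nlinarith [mul_pos hK₂ he, mul_nonneg hK0 he.le]

end rate

/-- faster than every exponential, in both directions -/
def FastDecay (h : ℝ → ℝ) : Prop := ∀ r : ℝ, ∃ C, ∀ z, h z * exp (r * z) ≤ C

lemma FastDecay.abs {h : ℝ → ℝ} (hd : FastDecay h) (h0 : ∀ z, 0 ≤ h z) (s : ℝ) :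
    ∃ C, ∀ z, h z * exp (s * z) ≤ C * exp (-|z|) := by
  obtain ⟨C1, h1⟩ := hd (s + 1)
  obtain ⟨C2, h2⟩ := hd (s - 1)
  refine ⟨C1 + C2, fun z => ?_⟩
  have a1 := h1 z
  have a2 := h2 z
  have p1 : 0 ≤ h z * exp ((s + 1) * z) := mul_nonneg (h0 z) (exp_pos _).le
  have p2 : 0 ≤ h z * exp ((s - 1) * z) := mul_nonneg (h0 z) (exp_pos _).le
  have key : h z * exp (s * z) * exp |z| ≤ C1 + C2 := by
    rcases le_total 0 z with hz | hz
    · rw [abs_of_nonneg hz, mul_assoc, ← exp_add]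
      have : s * z + z = (s + 1) * z := by ring
      rw [this]; linarith
    · rw [abs_of_nonpos hz, mul_assoc, ← exp_add]
      have : s * z + -z = (s - 1) * z := by ring
      rw [this]; linarith
  rw [exp_neg]
  rwa [← div_eq_mul_inv, le_div_iff₀ (exp_pos _)]

lemma FastDecay.VV {h : ℝ → ℝ} (hd : FastDecay h) (h0 : ∀ z, 0 ≤ h z) (p q d : ℝ) :
    ∃ C, ∀ z, h z * VV p q (z - d) ≤ C * exp (-|z|) := by
  obtain ⟨C1, h1⟩ := hd.abs h0 (-p)
  obtain ⟨C2, h2⟩ := hd.abs h0 q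
  refine ⟨exp (p * d) * C1 + exp (-(q * d)) * C2, fun z => ?_⟩
  have e1 : exp (-p * (z - d)) = exp (p * d) * exp (-p * z) := by rw [← exp_add]; ring_nf
  have e2 : exp (q * (z - d)) = exp (-(q * d)) * exp (q * z) := by rw [← exp_add]; ring_nf
  unfold _root_.VV
  rw [e1, e2]
  have a1 := mul_le_mul_of_nonneg_left (h1 z) (exp_pos (p * d)).le
  have a2 := mul_le_mul_of_nonneg_left (h2 z) (exp_pos (-(q * d))).le
  linarith

lemma FastDecay.growth {h b : ℝ → ℝ} (hd : FastDecay h) (h0 : ∀ z, 0 ≤ h z) {K γ : ℝ} (hK : 0 ≤ K)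
    (hb : ∀ z, b z ≤ K * (1 + exp (γ * z))) : FastDecay (fun z => b z * h z) := by
  intro r
  obtain ⟨C1, h1⟩ := hd r
  obtain ⟨C2, h2⟩ := hd (γ + r)
  refine ⟨K * (C1 + C2), fun z => ?_⟩
  have a1 := h1 z
  have a2 := h2 z
  rw [add_mul, exp_add] at a2
  calc b z * h z * exp (r * z) ≤ (K * (1 + exp (γ * z))) * h z * exp (r * z) := by
        have := h0 z
        have := hb z
        gcongr
    _ = K * (h z * exp (r * z) + h z * (exp (γ * z) * exp (r * z))) := by ring
    _ ≤ _ := by gcongr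

/-- Perron density in logarithmic coordinates. -/
def dens (U : ℝ → ℝ) (z : ℝ) : ℝ := exp (2 * z) * U (exp z)

section density
variable {B U U' : ℝ → ℝ}

lemma dens_nonneg (hU : Perron B U U') (z : ℝ) : 0 ≤ dens U z :=
  mul_nonneg (exp_pos _).le (hU.1 _ (exp_pos z))

lemma dens_deriv (hU : Perron B U U') (z : ℝ) :
    HasDerivAt (dens U) (B (exp (z + Real.log 2)) * dens U (z + Real.log 2)
      - B (exp z) * dens U z) z := by
  have d1 : HasDerivAt (fun z : ℝ => exp (2 * z)) (exp (2 * z) * 2) z := by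
    have := ((hasDerivAt_id z).const_mul 2).exp
    refine this.congr_deriv ?_
    simp
  have d2 := (hU.2.1 (exp z) (exp_pos z)).comp z (Real.hasDerivAt_exp z)
  have d3 := d1.mul d2
  refine d3.congr_deriv ?_
  have e1 : exp (z + Real.log 2) = 2 * exp z := by
    rw [exp_add, exp_log (by norm_num)]; ring
  have e2 : exp (2 * (z + Real.log 2)) = 4 * exp (2 * z) := by
    have : 2 * (z + Real.log 2) = 2 * z + (Real.log 2 + Real.log 2) := by ring
    rw [this, exp_add, exp_add, exp_log (by norm_num)]; ring
  unfold dens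
  rw [e1, e2]
  have h := hU.2.2.2.1 (exp z) (exp_pos z)
  simp only [Function.comp]
  linear_combination exp (2 * z) * h

lemma dens_cont (hU : Perron B U U') : Continuous (dens U) :=
  continuous_iff_continuousAt.2 fun z => (dens_deriv hU z).continuousAt

lemma dens_fast (hU : Perron B U U') : FastDecay (dens U) := by
  intro r
  obtain ⟨C, hC⟩ := (hU.2.2.2.2.2 (r + 2)).1
  refine ⟨C, fun z => ?_⟩
  have h := hC (exp z) (exp_pos z)
  rw [← exp_mul] at h
  refine le_trans (le_of_eq ?_) h
  unfold dens
  have : exp (z * (r + 2)) = exp (2 * z) * exp (r * z) := by rw [← exp_add]; ring_nf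
  rw [this]; ring

lemma dens_int (hU : Perron B U U') {p q : ℝ} :
    Integrable (fun w => dens U w * VV p q w) := by
  obtain ⟨C, hC⟩ := (dens_fast hU).VV (dens_nonneg hU) p q 0
  refine (integrable_exp_neg_abs'.const_mul C).mono' ?_ ?_
  · exact ((dens_cont hU).mul (VV_cont p q)).aestronglyMeasurable
  · refine Eventually.of_forall fun z => ?_
    rw [norm_eq_abs, abs_of_nonneg (mul_nonneg (dens_nonneg hU z) (VV_pos _ _ _).le)]
    simpa using hC z

lemma dens_int1 (hU : Perron B U U') : Integrable (dens U) := by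
  have := dens_int hU (p := 0) (q := 0)
  unfold VV at this
  simp only [neg_zero, zero_mul, exp_zero] at this
  have h2 := this.mul_const (1/2)
  refine h2.congr (Eventually.of_forall fun z => ?_)
  simp only; ring

lemma dens_one (hU : Perron B U U') : ∫ w, dens U w = 1 := by
  rw [← hU.2.2.2.2.1, ← integral_exp_line]
  congr 1
  funext z
  unfold dens
  have : exp (2 * z) = exp z * exp z := by rw [← exp_add]; ring_nf
  rw [this]; ring

end density

/-- Solution along a line, recentred. -/
def recen (m : ℝ → ℝ → ℝ) (c : ℝ) (t z : ℝ) : ℝ := if 0 ≤ t then m t z - c else 0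

lemma recen_solLine {b : ℝ → ℝ} {L p q : ℝ} (hp : 0 < p) (hq : 0 < q) {m : ℝ → ℝ → ℝ}
    (h : SolLine b L p q m) (c : ℝ) : SolLine b L p q (recen m c) := by
  refine ⟨?_, ?_, ?_⟩
  · intro z
    have h1 : ContinuousOn (fun t => m t z - c) (Ici 0) := (h.cont z).sub continuousOn_const
    exact h1.congr fun t ht => by simp only [recen, if_pos (mem_Ici.1 ht)]
  · intro z t ht
    have := ((h.der z t ht).sub_const c).congr (f₁ := fun t => recen m c t z)
      (fun s hs => by simp only [recen, if_pos (ht.le.trans (mem_Ici.1 hs))])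
      (by simp only [recen, if_pos ht.le])
    refine this.congr_deriv ?_
    simp only [recen, if_pos ht.le]
    ring
  · intro r hr
    obtain ⟨C, hC⟩ := h.bdd r hr
    refine ⟨C + |c|, fun t h0 h1 z => ?_⟩
    simp only [recen, if_pos h0]
    have h2 := hC t h0 h1 z
    have h3 := VV_ge_one hp hq (z - t)
    have h4 := abs_sub (m t z) c
    nlinarith [abs_nonneg c]

lemma mild_line {B f : ℝ → ℝ} {φ : ℝ → ℝ → ℝ} (hB : Bhyp B) (hφ : IsMildSol B f φ)
    {r₁ r₂ : ℝ}
    (hbd : ∀ r > 0, ∃ C, ∀ t, 0 ≤ t → t ≤ r → ∀ x > 0, |φ t x| ≤ C * (x ^ r₁ + x ^ r₂)) :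
    LineMild (fun z => B (exp z)) (fun z => f (exp z) * exp (-z)) (Real.log 2) (1 - r₁) (r₂ - 1)
      (fun t z => φ t (exp (z - t)) * exp (-z)) := by
  have hbc := b_cont hB
  refine ⟨?_, ?_⟩
  · intro t ht z
    have h := hφ t ht (exp (z - t)) (exp_pos _)
    set b : ℝ → ℝ := fun z => B (exp z) with hb
    have e1 : exp (z - t) * exp t = exp z := by rw [← exp_add]; ring_nf
    have e2 : ∀ s, B (exp (z - t) * exp s) = b (z - (t - s)) := by
      intro s; simp only [hb]; rw [← exp_add]; ring_nf
    have e3 : ∀ τ, ∫ s in (0:ℝ)..τ, b (z - (t - s)) = HH b t z - HH b (t - τ) z := by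
      intro τ
      rw [intervalIntegral.integral_comp_sub_left (fun s => b (z - s)) t]
      unfold HH
      have hc : Continuous fun s => b (z - s) := by fun_prop
      rw [intervalIntegral.integral_interval_sub_left (hc.intervalIntegrable _ _)
            (hc.intervalIntegrable _ _), sub_zero]
    have e4 : ∀ τ, exp (z - t) * exp τ / 2 = exp (z - Real.log 2 - (t - τ)) := by
      intro τ
      have : z - Real.log 2 - (t - τ) = z - t + τ - Real.log 2 := by ring
      rw [this, exp_sub _ (Real.log 2), exp_add, exp_log (by norm_num)]
    simp only [e1, e2, e3, e4] at h
    rw [h]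
    have e5 : HH b (t - t) z = 0 := by simp [HH]
    rw [e5, sub_zero]
    have e6 := intervalIntegral.integral_comp_sub_left (a := 0) (b := t)
      (fun s => b (z - s) * exp (-(HH b t z - HH b s z)) * φ s (exp (z - Real.log 2 - s))) t
    rw [sub_self, sub_zero] at e6
    rw [e6]
    have e7 : ∀ s, b (z - s) * exp (-(HH b t z - HH b s z)) * φ s (exp (z - Real.log 2 - s)) =
        (exp (-HH b t z) * exp z / 2) * (b (z - s) * exp (HH b s z) *
          (φ s (exp (z - Real.log 2 - s)) * exp (-(z - Real.log 2)))) := by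
      intro s
      have a1 : exp (-(HH b t z - HH b s z)) = exp (-HH b t z) * exp (HH b s z) := by
        rw [← exp_add]; ring_nf
      have a2 : exp (-(z - Real.log 2)) = exp (-z) * 2 := by
        have : -(z - Real.log 2) = -z + Real.log 2 := by ring
        rw [this, exp_add, exp_log (by norm_num)]
      have a3 : exp z * exp (-z) = 1 := by rw [← exp_add]; simp
      rw [a1, a2]
      linear_combination (-(b (z - s) * exp (-HH b t z) * exp (HH b s z) *
        φ s (exp (z - Real.log 2 - s)))) * a3
    simp only [e7]
    rw [intervalIntegral.integral_const_mul]
    have a3 : exp z * exp (-z) = 1 := by rw [← exp_add]; simp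
    set I := ∫ s in (0:ℝ)..t, b (z - s) * exp (HH b s z) *
          (φ s (exp (z - Real.log 2 - s)) * exp (-(z - Real.log 2)))
    linear_combination (exp (-HH b t z) * I) * a3
  · intro r hr
    obtain ⟨C, hC⟩ := hbd r hr
    refine ⟨C, fun t h0 h1 z => ?_⟩
    have h2 := hC t h0 h1 (exp (z - t)) (exp_pos _)
    rw [wVV] at h2
    have hV := VV_pos (1 - r₁) (r₂ - 1) (z - t)
    have hC0 : 0 ≤ C :=
      nonneg_of_mul_nonneg_left ((abs_nonneg _).trans h2) (mul_pos (exp_pos _) hV)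
    rw [abs_mul, abs_of_pos (exp_pos (-z))]
    have e1 : exp (z - t) * exp (-z) = exp (-t) := by rw [← exp_add]; ring_nf
    have e2 : exp (-t) ≤ 1 := exp_le_one_iff.2 (by linarith)
    calc |φ t (exp (z - t))| * exp (-z) ≤
        C * (exp (z - t) * VV (1 - r₁) (r₂ - 1) (z - t)) * exp (-z) := by gcongr
      _ = C * VV (1 - r₁) (r₂ - 1) (z - t) * (exp (z - t) * exp (-z)) := by ring
      _ ≤ C * VV (1 - r₁) (r₂ - 1) (z - t) * 1 := by rw [e1]; gcongr
      _ = _ := by ring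

/-- Quantified mean ergodicity in `B(w)`, `w(x) = x^{r₁} + x^{r₂}`, `r₁ < 1 < r₂`: there are
`C ≥ 1` and `a > 0` such that for every `f ∈ B(w)` and `t > 0`,
`‖(1/log 2)∫_t^{t+log 2} e^{-s}M_s f ds - ν₀(f)·id‖_{B(w)} ≤ C e^{-at} ‖f - ν₀(f)·id‖_{B(w)}`
and `‖(1/t)∫₀^t e^{-s}M_s f ds - ν₀(f)·id‖_{B(w)} ≤ (C/t) ‖f - ν₀(f)·id‖_{B(w)}`. -/
theorem stmt18 (B : ℝ → ℝ) (hB : Bhyp B) (hB2 : HypA2 B)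
    (U U' : ℝ → ℝ) (hU : Perron B U U')
    (r₁ r₂ : ℝ) (hr₁ : r₁ < 1) (hr₂ : 1 < r₂)
    (M : (ℝ → ℝ) → ℝ → ℝ → ℝ)
    (hM : ∀ g : ℝ → ℝ, (∃ D, ∀ x > 0, |g x| ≤ D * (x ^ r₁ + x ^ r₂)) →
      IsMildSol B g (M g) ∧
      ∀ r > 0, ∃ C, ∀ t, 0 ≤ t → t ≤ r → ∀ x > 0, |M g t x| ≤ C * (x ^ r₁ + x ^ r₂)) :
    ∃ C ≥ (1:ℝ), ∃ a > (0:ℝ), ∀ f : ℝ → ℝ, Measurable f →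
      (∃ D₀, ∀ x > 0, |f x| ≤ D₀ * (x ^ r₁ + x ^ r₂)) →
      ∀ D, (∀ x > 0, |f x - (∫ y in Ioi 0, U y * f y) * x| ≤ D * (x ^ r₁ + x ^ r₂)) →
        ∀ t > 0, ∀ x > 0,
          |(1 / Real.log 2) * (∫ s in t..(t + Real.log 2), exp (-s) * M f s x)
              - (∫ y in Ioi 0, U y * f y) * x|
            ≤ C * exp (-a * t) * D * (x ^ r₁ + x ^ r₂) ∧
          |(1 / t) * (∫ s in (0:ℝ)..t, exp (-s) * M f s x)
              - (∫ y in Ioi 0, U y * f y) * x|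
            ≤ (C / t) * D * (x ^ r₁ + x ^ r₂) := by
  set L := Real.log 2 with hLdef
  have hL : 0 < L := Real.log_pos (by norm_num)
  set p := 1 - r₁ with hpdef
  set q := r₂ - 1 with hqdef
  have hp : 0 < p := by linarith
  have hq : 0 < q := by linarith
  set b : ℝ → ℝ := fun z => B (exp z) with hb
  have hbc : Continuous b := b_cont hB
  have hb0 : ∀ z, 0 ≤ b z := b_nonneg hB
  have hbK : ∀ Z, ∃ K, ∀ z ≤ Z, b z ≤ K := b_bdd hB hB2
  have hbinf : Tendsto b atTop atTop := b_top hB2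
  obtain ⟨c, hc, K, hK, hLy⟩ := exists_lyap hbc hb0 (b_bot hB hB2) hbinf hL hp hq
  have hdn0 := dens_nonneg hU
  obtain ⟨C, hC, a, ha, havg⟩ := avg_bound hb0 hbK hbinf hL hp hq hc hK hLy (dens U) hdn0
    (dens_int1 hU) (dens_one hU) (dens_int hU)
  have h1x : 0 < 1 - exp (-a * L) := by
    have : exp (-a * L) < 1 := exp_lt_one_iff.2 (by nlinarith)
    linarith
  set C' := C / (1 - exp (-a * L)) + (1 + K / c) * L with hC'
  refine ⟨1 + C / L + C', ?_, a, ha, ?_⟩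
  · have : 0 ≤ C / L + C' := by positivity
    linarith
  intro f hf hD₀ D hD
  set c0 := ∫ y in Ioi 0, U y * f y with hc0
  obtain ⟨hmild, hbd⟩ := hM f hD₀
  obtain ⟨D₀, hD₀⟩ := hD₀
  have hD0 : 0 ≤ D := by
    have h1 := (abs_nonneg _).trans (hD 1 one_pos)
    simp only [one_rpow] at h1
    linarith
  have hline := mild_line hB hmild hbd
  rw [← hb, ← hLdef, ← hpdef, ← hqdef] at hline
  set g : ℝ → ℝ := fun z => f (exp z) * exp (-z) with hg
  set m : ℝ → ℝ → ℝ := fun t z => M f t (exp (z - t)) * exp (-z) with hm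
  have hgm : Measurable g := (hf.comp measurable_exp).mul (by fun_prop)
  set l := recen m c0 with hl
  have hsol : SolLine b L p q l := recen_solLine hp hq (hline.solLine hbc) c0
  have hmeas : Measurable (Function.uncurry l) := by
    have h1 := hline.meas hbc hb0 hbK hgm hL hp hq
    have h2 : Measurable (fun x : ℝ × ℝ => if 0 ≤ x.1 then c0 else 0) :=
      Measurable.ite (measurableSet_le measurable_const measurable_fst) measurable_const
        measurable_const
    have e : Function.uncurry l = (fun x : ℝ × ℝ => if 0 ≤ x.1 then m x.1 x.2 else 0) -
        fun x : ℝ × ℝ => if 0 ≤ x.1 then c0 else 0 := by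
      funext x
      simp only [Function.uncurry, hl, recen, Pi.sub_apply]
      split_ifs <;> simp
    rw [e]
    exact h1.sub h2
  have hneg : ∀ t < 0, ∀ z, l t z = 0 := by
    intro t ht z
    simp only [hl, recen, if_neg (not_le.2 ht)]
  have hl0 : ∀ z, l 0 z = g z - c0 := by
    intro z
    have h1 := hline.eq 0 le_rfl z
    simp only [HH, intervalIntegral.integral_same, neg_zero, exp_zero, one_mul, add_zero] at h1
    simp only [hl, recen, le_refl, if_true]
    rw [h1]
  have hA : ∀ z, |l 0 z| ≤ D * VV p q z := by
    intro z
    rw [hl0]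
    have h1 := hD (exp z) (exp_pos z)
    rw [wVV, ← hpdef, ← hqdef] at h1
    have e1 : g z - c0 = exp (-z) * (f (exp z) - c0 * exp z) := by
      have a3 : exp (-z) * exp z = 1 := by rw [← exp_add]; simp
      simp only [hg]
      linear_combination c0 * a3
    rw [e1, abs_mul, abs_of_pos (exp_pos _)]
    calc exp (-z) * |f (exp z) - c0 * exp z| ≤ exp (-z) * (D * (exp z * VV p q z)) := by gcongr
      _ = D * VV p q z * (exp (-z) * exp z) := by ring
      _ = _ := by rw [← exp_add]; simp
  have hgi : Integrable (fun w => dens U w * g w) := by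
    refine ((dens_int hU (p := p) (q := q)).const_mul D₀).mono' ?_ ?_
    · exact ((dens_cont hU).measurable.mul hgm).aestronglyMeasurable
    · refine Eventually.of_forall fun z => ?_
      rw [norm_eq_abs, abs_mul, abs_of_nonneg (hdn0 z)]
      have h1 := hD₀ (exp z) (exp_pos z)
      rw [wVV, ← hpdef, ← hqdef] at h1
      have h2 : |g z| ≤ D₀ * VV p q z := by
        simp only [hg]
        rw [abs_mul, abs_of_pos (exp_pos _)]
        calc |f (exp z)| * exp (-z) ≤ (D₀ * (exp z * VV p q z)) * exp (-z) := by gcongr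
          _ = D₀ * VV p q z * (exp (-z) * exp z) := by ring
          _ = _ := by rw [← exp_add]; simp
      have := mul_le_mul_of_nonneg_left h2 (hdn0 z)
      linarith
  have hgc : ∫ w, dens U w * g w = c0 := by
    rw [hc0, ← integral_exp_line]
    congr 1
    funext z
    simp only [dens, hg]
    have e1 : exp (2 * z) * exp (-z) = exp z := by rw [← exp_add]; ring_nf
    linear_combination (U (exp z) * f (exp z)) * e1
  have hinv : ∀ t ≥ 0, ∫ w, dens U w * l t (w + t) = 0 := by
    intro t ht
    obtain ⟨Kg, hKg, γ, hgr⟩ := b_growth hB hB2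
    have hQ := ((dens_fast hU).growth hdn0 hKg hgr).VV
      (fun z => mul_nonneg (b_nonneg hB z) (hdn0 z)) p q L
    have hDD := (dens_fast hU).VV hdn0 p q 0
    rw [invariance hbc hb0 (dens_deriv hU) (p := p) (q := q) ?_ ?_ hsol hmeas t ht]
    · simp only [hl0, mul_sub]
      rw [integral_sub hgi ((dens_int1 hU).mul_const _), hgc, integral_mul_const, dens_one hU]
      ring
    · obtain ⟨C, hC⟩ := hQ
      exact ⟨C, fun y => by rw [abs_of_nonneg (hdn0 y)]; exact hC y⟩
    · obtain ⟨C, hC⟩ := hDD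
      exact ⟨C, fun y => by rw [abs_of_nonneg (hdn0 y)]; simpa using hC y⟩
  have hmain := havg l hsol hmeas hneg D hD0 hA hinv
  have hbound : ∀ t w, |l t (w + t)| ≤ D * (VV p q w + K / c) := by
    intro t w
    rcases lt_or_ge t 0 with h | h
    · rw [hneg t h]
      have := VV_pos p q w
      simp only [abs_zero]; positivity
    · have := lyap_bound hb0 hbK hL hp hq hc hK.le hLy hsol D hD0 hA (w + t) t h
      simpa using this
  have hItg : ∀ w s1 s2, IntervalIntegrable (fun s => l s (w + s)) volume s1 s2 := by
    intro w s1 s2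
    have hm1 : Measurable (fun s => l s (w + s)) :=
      hmeas.comp (measurable_id.prodMk (measurable_const.add measurable_id))
    refine (intervalIntegrable_const (c := D * (VV p q w + K / c))).mono_fun
      hm1.aestronglyMeasurable ?_
    exact Eventually.of_forall fun s => (hbound s w).trans (le_abs_self _)
  intro t ht x hx
  set w := Real.log x with hw
  have hxw : exp w = x := exp_log hx
  have hxV : x ^ r₁ + x ^ r₂ = x * VV p q w := by
    rw [← hxw, wVV]
  have hV1 := VV_ge_one hp hq w
  have hV0 := VV_pos p q w
  have hMl : ∀ s ≥ 0, exp (-s) * M f s x = x * l s (w + s) + c0 * x := by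
    intro s hs
    simp only [hl, recen, if_pos hs.le, hm, add_sub_cancel_right, hxw]
    have e1 : x * exp (-(w + s)) = exp (-s) := by rw [← hxw, ← exp_add]; ring_nf
    linear_combination (-(M f s x)) * e1
  have hIl : ∀ s1 s2, 0 ≤ s1 → s1 ≤ s2 → ∫ s in s1..s2, exp (-s) * M f s x =
      x * (∫ s in s1..s2, l s (w + s)) + c0 * x * (s2 - s1) := by
    intro s1 s2 h0 h1
    rw [intervalIntegral.integral_congr (g := fun s => x * l s (w + s) + c0 * x)]
    · rw [intervalIntegral.integral_add ((hItg w _ _).const_mul x) intervalIntegrable_const,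
        intervalIntegral.integral_const_mul, intervalIntegral.integral_const, smul_eq_mul]
      ring
    · intro s hs
      rw [uIcc_of_le h1] at hs
      exact hMl s (h0.trans hs.1)
  constructor
  · rw [hIl t (t + L) ht.le (by linarith), hxV]
    have e1 : 1 / L * (x * (∫ s in t..(t + L), l s (w + s)) + c0 * x * (t + L - t)) - c0 * x =
        x / L * (∫ s in t..(t + L), l s (w + s)) := by
      field_simp
      ring
    rw [e1, abs_mul, abs_of_pos (by positivity)]
    have h1 := hmain t ht.le w
    calc x / L * |∫ s in t..(t + L), l s (w + s)| ≤ x / L * (C * D * exp (-a * t) * VV p q w) := by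
          gcongr
      _ = C / L * (exp (-a * t) * D * (x * VV p q w)) := by ring
      _ ≤ (1 + C / L + C') * (exp (-a * t) * D * (x * VV p q w)) := by
          have : 0 ≤ C' := by positivity
          gcongr
          linarith
      _ = _ := by ring
  · rw [hIl 0 t le_rfl ht.le, hxV]
    have e1 : 1 / t * (x * (∫ s in (0:ℝ)..t, l s (w + s)) + c0 * x * (t - 0)) - c0 * x =
        x / t * (∫ s in (0:ℝ)..t, l s (w + s)) := by
      field_simp
      ring
    rw [e1, abs_mul, abs_of_pos (by positivity)]
    have h1 := primitive_bound (X := C * D * VV p q w) (Y := D * (VV p q w + K / c)) hL ha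
      (by positivity) (fun s => l s (w + s)) (hItg w) (fun s => hbound s w)
      (fun s hs => (hmain s hs w).trans (le_of_eq (by ring))) t ht.le
    have h2 : C * D * VV p q w / (1 - exp (-a * L)) + D * (VV p q w + K / c) * L ≤
        C' * (D * VV p q w) := by
      have h3 : K / c ≤ K / c * VV p q w := le_mul_of_one_le_right (by positivity) hV1
      calc C * D * VV p q w / (1 - exp (-a * L)) + D * (VV p q w + K / c) * L ≤
          C * D * VV p q w / (1 - exp (-a * L)) + D * (VV p q w + K / c * VV p q w) * L := by
            gcongr
        _ = _ := by rw [hC']; ring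
    calc x / t * |∫ s in (0:ℝ)..t, l s (w + s)| ≤ x / t * (C' * (D * VV p q w)) := by
          gcongr
          exact h1.trans h2
      _ = C' * (1 / t * D * (x * VV p q w)) := by ring
      _ ≤ (1 + C / L + C') * (1 / t * D * (x * VV p q w)) := by
          have : 0 ≤ C / L := by positivity
          gcongr
          linarith
      _ = _ := by ring
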